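/- (Time-uniform estimate of ξ) Let (ρ, u) be a radially symmetric strong solution on [0,R] × [0,T], set R_T = 1 + sup_{[0,R]×[0,T]} ρ and ξ(r,t) = ∫_R^r ρ(s,t) u(s,t) ds. Then for any α ∈ (0,1) there is a constant C(α) depending only on α, μ, β, γ, ‖ρ₀‖_{L^∞} and ‖u₀‖_{H¹} (independent of T) such that sup_{[0,R]×[0,T]} |ξ| ≤ C(α) ( R_T^{1+αβ} + R_T^{1+γ/2−β} ). -/

import Mathlib

open MeasureTheory Set Filter

noncomputable section

/-- Radial divergence `u_r + u/r` of the 2D radial vector field `x ↦ u(|x|,t) x/|x|`. -/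
def rdiv (u : ℝ → ℝ → ℝ) (r t : ℝ) : ℝ := deriv (fun s => u s t) r + u r t / r

/-- Squared gradient `u_r² + u²/r²` of the 2D radial vector field. -/
def gradSq (u : ℝ → ℝ → ℝ) (r t : ℝ) : ℝ :=
  (deriv (fun s => u s t) r) ^ 2 + (u r t / r) ^ 2

/-- Material derivative `u̇ = u_t + u u_r` of the radial velocity. -/
def mder (u : ℝ → ℝ → ℝ) (r t : ℝ) : ℝ :=
  deriv (fun τ => u r τ) t + u r t * deriv (fun s => u s t) r

/-- Effective viscous flux `F = (2μ + ρ^β)(u_r + u/r) - ρ^γ`. -/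
def flux (μ β γ : ℝ) (ρ u : ℝ → ℝ → ℝ) (r t : ℝ) : ℝ :=
  (2 * μ + ρ r t ^ β) * rdiv u r t - ρ r t ^ γ

/-- A radially symmetric (smooth, strong) solution on `[0,R] × [0,T]` of the isentropic
compressible Navier–Stokes system with `μ > 0`, `λ(ρ) = ρ^β`, `P(ρ) = ρ^γ`, written in
radial coordinates: `ρ_t + (ρu)_r + ρu/r = 0` and
`(ρu)_t + (ρu²)_r + ρu²/r + (ρ^γ)_r = [(2μ + ρ^β)(u_r + u/r)]_r`, with Dirichlet
boundary conditions `u(0,t) = u(R,t) = 0`. -/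
structure RadialSolution (μ β γ R T : ℝ) (ρ u : ℝ → ℝ → ℝ) : Prop where
  hμ : 0 < μ
  hβ : 1 < β
  hγ : 1 < γ
  hR : 0 < R
  hT : 0 < T
  smooth_ρ : ∀ n : ℕ, ContDiff ℝ n (Function.uncurry ρ)
  smooth_u : ∀ n : ℕ, ContDiff ℝ n (Function.uncurry u)
  ρ_pos : ∀ r ∈ Icc 0 R, ∀ t ∈ Icc 0 T, 0 < ρ r t
  mass : ∀ r ∈ Ioo 0 R, ∀ t ∈ Icc 0 T,
    deriv (fun τ => ρ r τ) t + deriv (fun s => ρ s t * u s t) r + ρ r t * u r t / r = 0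
  momentum : ∀ r ∈ Ioo 0 R, ∀ t ∈ Icc 0 T,
    deriv (fun τ => ρ r τ * u r τ) t + deriv (fun s => ρ s t * u s t ^ 2) r
      + ρ r t * u r t ^ 2 / r + deriv (fun s => ρ s t ^ γ) r
      = deriv (fun s => (2 * μ + ρ s t ^ β) * rdiv u s t) r
  bc0 : ∀ t ∈ Icc 0 T, u 0 t = 0
  bcR : ∀ t ∈ Icc 0 T, u R t = 0

section
open MeasureTheory Set Filter
open scoped Topology ContDiff
noncomputable section

/-- joint smoothness -/
def Sm (f : ℝ → ℝ → ℝ) : Prop := ContDiff ℝ ∞ (Function.uncurry f)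
/-- partial derivatives -/
def pr (f : ℝ → ℝ → ℝ) (r t : ℝ) : ℝ := deriv (fun s => f s t) r
def pt (f : ℝ → ℝ → ℝ) (r t : ℝ) : ℝ := deriv (fun τ => f r τ) t

lemma Sm.hasr {f} (h : Sm f) (r t : ℝ) :
    HasDerivAt (fun s => f s t) (fderiv ℝ (Function.uncurry f) (r, t) (1, 0)) r := by
  have h1 : HasFDerivAt (Function.uncurry f) (fderiv ℝ (Function.uncurry f) (r, t)) (r, t) :=
    (h.differentiable (by simp) (r, t)).hasFDerivAt
  have h2 : HasDerivAt (fun s : ℝ => (s, t)) ((1 : ℝ), (0 : ℝ)) r :=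
    (hasDerivAt_id r).prodMk (hasDerivAt_const r t)
  exact h1.comp_hasDerivAt r h2

lemma Sm.hast {f} (h : Sm f) (r t : ℝ) :
    HasDerivAt (fun s => f r s) (fderiv ℝ (Function.uncurry f) (r, t) (0, 1)) t := by
  have h1 : HasFDerivAt (Function.uncurry f) (fderiv ℝ (Function.uncurry f) (r, t)) (r, t) :=
    (h.differentiable (by simp) (r, t)).hasFDerivAt
  have h2 : HasDerivAt (fun s : ℝ => (r, s)) ((0 : ℝ), (1 : ℝ)) t :=
    (hasDerivAt_const t r).prodMk (hasDerivAt_id t)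
  exact h1.comp_hasDerivAt t h2

lemma Sm.hr {f} (h : Sm f) (r t : ℝ) : HasDerivAt (fun s => f s t) (pr f r t) r := by
  have := h.hasr r t
  rw [pr, this.deriv]; exact this

lemma Sm.ht {f} (h : Sm f) (r t : ℝ) : HasDerivAt (fun s => f r s) (pt f r t) t := by
  have := h.hast r t
  rw [pt, this.deriv]; exact this

lemma Sm.pr_eq {f} (h : Sm f) :
    Function.uncurry (pr f) = fun x => fderiv ℝ (Function.uncurry f) x (1, 0) := by
  ext ⟨r, t⟩; exact (h.hasr r t).deriv

lemma Sm.pt_eq {f} (h : Sm f) :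
    Function.uncurry (pt f) = fun x => fderiv ℝ (Function.uncurry f) x (0, 1) := by
  ext ⟨r, t⟩; exact (h.hast r t).deriv

lemma Sm.fd {f} (h : Sm f) : ContDiff ℝ ∞ (fderiv ℝ (Function.uncurry f)) :=
  h.fderiv_right (by simp)

lemma Sm.pr {f} (h : Sm f) : Sm (pr f) := by
  rw [Sm, h.pr_eq]; exact h.fd.clm_apply contDiff_const

lemma Sm.pt {f} (h : Sm f) : Sm (pt f) := by
  rw [Sm, h.pt_eq]; exact h.fd.clm_apply contDiff_const

lemma Sm.cont {f} (h : Sm f) : Continuous (Function.uncurry f) := h.continuous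

lemma Sm.comm {f} (h : Sm f) (r t : ℝ) : _root_.pr (_root_.pt f) r t = _root_.pt (_root_.pr f) r t := by
  have e1 : _root_.pr (_root_.pt f) r t = fderiv ℝ (fun x => fderiv ℝ (Function.uncurry f) x (0, 1)) (r, t) (1, 0) := by
    rw [← h.pt_eq]; exact congrFun h.pt.pr_eq (r, t)
  have e2 : _root_.pt (_root_.pr f) r t = fderiv ℝ (fun x => fderiv ℝ (Function.uncurry f) x (1, 0)) (r, t) (0, 1) := by
    rw [← h.pr_eq]; exact congrFun h.pr.pt_eq (r, t)
  have hd := (h.fd.differentiable (by simp) (r, t))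
  have sy : IsSymmSndFDerivAt ℝ (Function.uncurry f) (r, t) :=
    (h.contDiffAt).isSymmSndFDerivAt (by simp only [minSmoothness_of_isRCLikeNormedField]; exact WithTop.coe_le_coe.2 (le_top : (2 : ℕ∞) ≤ ⊤))
  rw [e1, e2, fderiv_clm_apply hd (by fun_prop), fderiv_clm_apply hd (by fun_prop)]
  simpa using sy.eq (1, 0) (0, 1)

lemma contDiff_param_nat (n : ℕ) : ∀ (F : Type) [NormedAddCommGroup F] [NormedSpace ℝ F] [CompleteSpace F]
    (f : (ℝ × ℝ) × ℝ → F), ContDiff ℝ n f →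
    ContDiff ℝ n (fun x : ℝ × ℝ => ∫ s in (0:ℝ)..1, f (x, s)) := by
  induction n with
  | zero =>
    intro F _ _ _ f hf
    have hc : Continuous f := hf.continuous
    refine contDiff_zero.2 ?_
    exact intervalIntegral.continuous_parametric_intervalIntegral_of_continuous' (f := fun x s => f (x, s)) hc 0 1
  | succ n ih =>
    intro F _ _ _ f hf
    have hf1 : ContDiff ℝ n (fun p : (ℝ × ℝ) × ℝ => (fderiv ℝ f p).comp (ContinuousLinearMap.inl ℝ (ℝ × ℝ) ℝ)) :=
      (hf.fderiv_right (by norm_cast)).clm_comp contDiff_const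
    have ih' := ih _ _ hf1
    refine contDiff_succ_iff_hasFDerivAt.2 ⟨_, ih', ?_⟩
    intro x₀
    have hdiff : ∀ (x : ℝ × ℝ) (s : ℝ), HasFDerivAt (fun x => f (x, s)) ((fderiv ℝ f (x, s)).comp (ContinuousLinearMap.inl ℝ (ℝ × ℝ) ℝ)) x := by
      intro x s
      have h1 : HasFDerivAt f (fderiv ℝ f (x, s)) (x, s) :=
        (hf.differentiable (by simp) (x, s)).hasFDerivAt
      exact h1.comp x (hasFDerivAt_prodMk_left x s)
    have hfc : Continuous f := hf.continuous
    have hcomp : IsCompact (Metric.closedBall x₀ 1 ×ˢ Icc (0:ℝ) 1) :=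
      (isCompact_closedBall x₀ 1).prod isCompact_Icc
    obtain ⟨C, hC⟩ := hcomp.exists_bound_of_continuousOn (hf1.continuous.continuousOn)
    refine intervalIntegral.hasFDerivAt_integral_of_dominated_of_fderiv_le (bound := fun _ => C)
      (F' := fun x s => (fderiv ℝ f (x, s)).comp (ContinuousLinearMap.inl ℝ (ℝ × ℝ) ℝ))
      (Metric.closedBall_mem_nhds x₀ one_pos) ?_ ?_ ?_ ?_ ?_ ?_
    · refine Eventually.of_forall fun x => ?_
      exact (Continuous.aestronglyMeasurable (by fun_prop))
    · exact Continuous.intervalIntegrable (by fun_prop) _ _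
    · have := hf1.continuous.comp (Continuous.prodMk_right x₀)
      exact this.aestronglyMeasurable
    · refine ae_of_all _ fun s hs x hx => ?_
      rw [uIoc_of_le zero_le_one] at hs
      exact hC (x, s) ⟨hx, hs.1.le, hs.2⟩
    · exact intervalIntegrable_const
    · exact ae_of_all _ fun s _ x _ => hdiff x s

/-- Hadamard quotient. -/
def hq (u : ℝ → ℝ → ℝ) (r t : ℝ) : ℝ := ∫ s in (0:ℝ)..1, pr u (s * r) t

lemma Sm.hq {u} (h : Sm u) : Sm (hq u) := by
  refine contDiff_infty.2 fun n => ?_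
  have h1 : ContDiff ℝ n (fun p : (ℝ × ℝ) × ℝ => Function.uncurry (_root_.pr u) (p.2 * p.1.1, p.1.2)) := by
    have := (contDiff_infty.1 h.pr n)
    refine this.comp ?_
    fun_prop
  exact contDiff_param_nat n ℝ _ h1

lemma hq_mul {u} (h : Sm u) (r t : ℝ) : r * hq u r t = u r t - u 0 t := by
  have h1 : ∫ s in (0:ℝ)..1, r * pr u (s * r) t = u (1 * r) t - u (0 * r) t := by
    refine intervalIntegral.integral_eq_sub_of_hasDerivAt (f := fun s => u (s * r) t) ?_ ?_
    · intro s _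
      have := (h.hr (s * r) t).comp s ((hasDerivAt_id s).mul_const r)
      refine this.congr_deriv ?_
      simp [mul_comm]
    · refine Continuous.intervalIntegrable ?_ _ _
      have : Continuous fun s : ℝ => Function.uncurry (_root_.pr u) (s * r, t) := h.pr.cont.comp (by fun_prop)
      exact continuous_const.mul this
  rw [hq, ← intervalIntegral.integral_const_mul, h1]; simp

/-- differentiation under the integral -/
lemma deriv_under {R T : ℝ} (hR : 0 < R) {g gt : ℝ → ℝ → ℝ}
    (hg : ContinuousOn (Function.uncurry g) (Icc 0 R ×ˢ Icc 0 T))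
    (hgt : ContinuousOn (Function.uncurry gt) (Icc 0 R ×ˢ Icc 0 T))
    (hd : ∀ r ∈ Icc 0 R, ∀ t ∈ Ioo 0 T, HasDerivAt (fun τ => g r τ) (gt r t) t)
    {t : ℝ} (ht : t ∈ Ioo 0 T) :
    HasDerivAt (fun τ => ∫ r in (0:ℝ)..R, g r τ) (∫ r in (0:ℝ)..R, gt r t) t := by
  have sl : ∀ (f : ℝ → ℝ → ℝ), ContinuousOn (Function.uncurry f) (Icc 0 R ×ˢ Icc 0 T) → ∀ τ ∈ Icc 0 T,
      ContinuousOn (fun r => f r τ) (Icc 0 R) := by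
    intro f hf τ hτ
    exact hf.comp (f := fun r => (r, τ)) (by fun_prop) (fun r hr => ⟨hr, hτ⟩)
  obtain ⟨C, hC⟩ := (isCompact_Icc.prod isCompact_Icc).exists_bound_of_continuousOn hgt
  have hu : uIoc 0 R = Ioc 0 R := uIoc_of_le hR.le
  refine (intervalIntegral.hasDerivAt_integral_of_dominated_loc_of_deriv_le (bound := fun _ => C)
    (F := fun τ r => g r τ) (F' := fun τ r => gt r τ)
    (Ioo_mem_nhds ht.1 ht.2) ?_ ?_ ?_ ?_ ?_ ?_).2
  · filter_upwards [Ioo_mem_nhds ht.1 ht.2] with τ hτ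
    rw [hu]
    exact ((sl g hg τ ⟨hτ.1.le, hτ.2.le⟩).mono Ioc_subset_Icc_self).aestronglyMeasurable measurableSet_Ioc
  · exact ContinuousOn.intervalIntegrable (by rw [uIcc_of_le hR.le]; exact sl g hg t ⟨ht.1.le, ht.2.le⟩)
  · rw [hu]
    exact ((sl gt hgt t ⟨ht.1.le, ht.2.le⟩).mono Ioc_subset_Icc_self).aestronglyMeasurable measurableSet_Ioc
  · refine ae_of_all _ fun r hr τ hτ => ?_
    rw [hu] at hr
    exact hC (r, τ) ⟨⟨hr.1.le, hr.2⟩, hτ.1.le, hτ.2.le⟩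
  · exact intervalIntegrable_const
  · refine ae_of_all _ fun r hr τ hτ => ?_
    rw [hu] at hr
    exact hd r ⟨hr.1.le, hr.2⟩ τ hτ

lemma cont_under {R T : ℝ} (hR : 0 < R) {g : ℝ → ℝ → ℝ}
    (hg : ContinuousOn (Function.uncurry g) (Icc 0 R ×ˢ Icc 0 T)) :
    ContinuousOn (fun τ => ∫ r in (0:ℝ)..R, g r τ) (Icc 0 T) := by
  obtain ⟨C, hC⟩ := (isCompact_Icc.prod isCompact_Icc).exists_bound_of_continuousOn hg
  have hu : uIoc 0 R = Ioc 0 R := uIoc_of_le hR.le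
  intro t ht
  refine intervalIntegral.continuousWithinAt_of_dominated_interval (bound := fun _ => C) ?_ ?_ ?_ ?_
  · filter_upwards [self_mem_nhdsWithin] with τ hτ
    rw [hu]
    have : ContinuousOn (fun r => g r τ) (Icc 0 R) :=
      hg.comp (f := fun r => (r, τ)) (by fun_prop) (fun r hr => ⟨hr, hτ⟩)
    exact (this.mono Ioc_subset_Icc_self).aestronglyMeasurable measurableSet_Ioc
  · filter_upwards [self_mem_nhdsWithin] with τ hτ
    refine ae_of_all _ fun r hr => ?_
    rw [hu] at hr
    exact hC (r, τ) ⟨⟨hr.1.le, hr.2⟩, hτ⟩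
  · exact intervalIntegrable_const
  · refine ae_of_all _ fun r hr => ?_
    rw [hu] at hr
    have : ContinuousOn (fun τ => g r τ) (Icc 0 T) :=
      hg.comp (f := fun τ => (r, τ)) (by fun_prop) (fun τ hτ => ⟨⟨hr.1.le, hr.2⟩, hτ⟩)
    exact this t ht

/-- Reynolds transport in weighted radial form, `u = r w`. -/
lemma reynolds {R T : ℝ} (hR : 0 < R) {w g gt gr : ℝ → ℝ → ℝ} (hw : Sm w)
    (hwR : ∀ t ∈ Icc 0 T, w R t = 0)
    (hg : ContinuousOn (Function.uncurry g) (Icc 0 R ×ˢ Icc 0 T))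
    (hgt : ContinuousOn (Function.uncurry gt) (Icc 0 R ×ˢ Icc 0 T))
    (hgr : ContinuousOn (Function.uncurry gr) (Icc 0 R ×ˢ Icc 0 T))
    (hd : ∀ r ∈ Icc 0 R, ∀ t ∈ Ioo 0 T, HasDerivAt (fun τ => g r τ) (gt r t) t)
    (hdr : ∀ r ∈ Icc 0 R, ∀ t ∈ Ioo 0 T, HasDerivAt (fun s => g s t) (gr r t) r)
    {t : ℝ} (ht : t ∈ Ioo 0 T) :
    HasDerivAt (fun τ => ∫ r in (0:ℝ)..R, g r τ * r)
      (∫ r in (0:ℝ)..R, (gt r t + r * w r t * gr r t + g r t * (2 * w r t + r * pr w r t)) * r) t := by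
  have ht' : t ∈ Icc 0 T := ⟨ht.1.le, ht.2.le⟩
  have sl : ∀ (f : ℝ → ℝ → ℝ), ContinuousOn (Function.uncurry f) (Icc 0 R ×ˢ Icc 0 T) → 
      ContinuousOn (fun r => f r t) (uIcc 0 R) := by
    intro f hf
    rw [uIcc_of_le hR.le]
    exact hf.comp (f := fun r => (r, t)) (by fun_prop) (fun r hr => ⟨hr, ht'⟩)
  have c1 := sl g hg
  have c2 := sl gt hgt
  have c3 := sl gr hgr
  have c4 : ContinuousOn (fun r => w r t) (uIcc 0 R) := sl w hw.cont.continuousOn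
  have c5 : ContinuousOn (fun r => pr w r t) (uIcc 0 R) := sl _ hw.pr.cont.continuousOn
  have h1 := deriv_under hR (g := fun r t => g r t * r) (gt := fun r t => gt r t * r)
    (hg.mul (by fun_prop)) (hgt.mul (by fun_prop)) (fun r hr t ht => (hd r hr t ht).mul_const r) ht
  have h2 : ∫ r in (0:ℝ)..R, (r * w r t * gr r t + g r t * (2 * w r t + r * pr w r t)) * r = 0 := by
    have := intervalIntegral.integral_eq_sub_of_hasDerivAt (a := 0) (b := R)
      (f := fun r => r ^ 2 * w r t * g r t)
      (f' := fun r => (r * w r t * gr r t + g r t * (2 * w r t + r * pr w r t)) * r) ?_ ?_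
    · rw [this, hwR t ht']; simp
    · intro r hr
      rw [uIcc_of_le hR.le] at hr
      have := (((hasDerivAt_id r).pow 2).mul (hw.hr r t)).mul (hdr r hr t ht)
      refine this.congr_deriv ?_
      simp
      ring
    · exact ContinuousOn.intervalIntegrable (by fun_prop)
  refine h1.congr_deriv ?_
  have h3 : ∫ r in (0:ℝ)..R, (gt r t + r * w r t * gr r t + g r t * (2 * w r t + r * pr w r t)) * r
      = (∫ r in (0:ℝ)..R, gt r t * r)
        + ∫ r in (0:ℝ)..R, (r * w r t * gr r t + g r t * (2 * w r t + r * pr w r t)) * r := by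
    rw [← intervalIntegral.integral_add]
    · refine intervalIntegral.integral_congr fun r _ => ?_
      ring
    · exact ContinuousOn.intervalIntegrable (by fun_prop)
    · exact ContinuousOn.intervalIntegrable (by fun_prop)
  rw [h3, h2, add_zero]
end
end

section
open MeasureTheory Set Filter
open scoped Topology ContDiff
noncomputable section

lemma cs_int {a b : ℝ} (hab : a ≤ b) {f g k : ℝ → ℝ} (hf : ContinuousOn f (Icc a b))
    (hg : ContinuousOn g (Icc a b)) (hk : ContinuousOn k (Icc a b)) (hk0 : ∀ x ∈ Icc a b, 0 ≤ k x) :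
    (∫ x in a..b, f x * g x * k x) ^ 2 ≤ (∫ x in a..b, f x ^ 2 * k x) * (∫ x in a..b, g x ^ 2 * k x) := by
  rw [← uIcc_of_le hab] at hf hg hk
  have key : ∀ y : ℝ, 0 ≤ (∫ x in a..b, f x ^ 2 * k x) * (y * y)
      + (2 * ∫ x in a..b, f x * g x * k x) * y + (∫ x in a..b, g x ^ 2 * k x) := by
    intro y
    have h : 0 ≤ ∫ x in a..b, (f x * y + g x) ^ 2 * k x :=
      intervalIntegral.integral_nonneg hab fun x hx => mul_nonneg (sq_nonneg _) (hk0 x hx)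
    have e : ∫ x in a..b, (f x * y + g x) ^ 2 * k x
        = ∫ x in a..b, ((y * y) * (f x ^ 2 * k x) + (2 * y) * (f x * g x * k x) + g x ^ 2 * k x) := by
      refine intervalIntegral.integral_congr fun x _ => ?_
      ring
    rw [e, intervalIntegral.integral_add, intervalIntegral.integral_add,
      intervalIntegral.integral_const_mul, intervalIntegral.integral_const_mul] at h
    · linarith
    all_goals exact ContinuousOn.intervalIntegrable (by fun_prop)
  have := discrim_le_zero key
  unfold discrim at this
  nlinarith

lemma cs_int' {a b : ℝ} (hab : a ≤ b) {f g k : ℝ → ℝ} (hf : ContinuousOn f (Icc a b))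
    (hg : ContinuousOn g (Icc a b)) (hk : ContinuousOn k (Icc a b)) (hk0 : ∀ x ∈ Icc a b, 0 ≤ k x) :
    |∫ x in a..b, f x * g x * k x| ≤ √(∫ x in a..b, f x ^ 2 * k x) * √(∫ x in a..b, g x ^ 2 * k x) := by
  have h1 : 0 ≤ ∫ x in a..b, f x ^ 2 * k x :=
    intervalIntegral.integral_nonneg hab fun x hx => mul_nonneg (sq_nonneg _) (hk0 x hx)
  rw [← Real.sqrt_mul h1]
  exact Real.abs_le_sqrt (cs_int hab hf hg hk hk0)

/-- an integral over a subinterval of a nonnegative function -/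
lemma sub_int {R x y : ℝ} {f : ℝ → ℝ} (hf : ContinuousOn f (Icc 0 R)) (h0 : ∀ s ∈ Icc 0 R, 0 ≤ f s)
    (hx : 0 ≤ x) (hxy : x ≤ y) (hy : y ≤ R) : ∫ s in x..y, f s ≤ ∫ s in (0:ℝ)..R, f s := by
  refine intervalIntegral.integral_mono_interval hx hxy hy ?_ ?_
  · refine (ae_restrict_iff' measurableSet_Ioc).2 (ae_of_all _ fun s hs => h0 s ⟨hs.1.le, hs.2⟩)
  · exact ContinuousOn.intervalIntegrable (by rwa [uIcc_of_le (hx.trans (hxy.trans hy))])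

section hardy
variable {R : ℝ} {w w' : ℝ → ℝ}

lemma hardy_eq (hwc : Continuous w) (hwc' : Continuous w')
    (hw : ∀ r, HasDerivAt w (w' r) r) (x : ℝ) :
    ∫ r in (0:ℝ)..x, 2 * r * (w r * (w r + r * w' r)) = (x * w x) ^ 2 := by
  have := intervalIntegral.integral_eq_sub_of_hasDerivAt (a := 0) (b := x)
      (f := fun r => (r * w r) ^ 2)
      (f' := fun r => 2 * r * (w r * (w r + r * w' r))) ?_ ?_
  · rw [this]; simp
  · intro r hr
    have := ((hasDerivAt_id r).mul (hw r)).pow 2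
    refine this.congr_deriv ?_
    simp
    ring
  · exact Continuous.intervalIntegrable (by fun_prop) _ _

lemma hardy_id (hwc : Continuous w) (hwc' : Continuous w')
    (hw : ∀ r, HasDerivAt w (w' r) r) (hwR : w R = 0) :
    ∫ r in (0:ℝ)..R, (2 * w r + r * w' r) ^ 2 * r = ∫ r in (0:ℝ)..R, ((w r + r * w' r) ^ 2 + w r ^ 2) * r := by
  have h := hardy_eq hwc hwc' hw R
  rw [hwR] at h
  have : ∫ r in (0:ℝ)..R, (2 * w r + r * w' r) ^ 2 * r = ∫ r in (0:ℝ)..R, (((w r + r * w' r) ^ 2 + w r ^ 2) * r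
     + 2 * r * (w r * (w r + r * w' r))) := by
    refine intervalIntegral.integral_congr fun x _ => ?_
    ring
  rw [this, intervalIntegral.integral_add, h]
  · simp
  all_goals exact Continuous.intervalIntegrable (by fun_prop) _ _

lemma hardy_sup (hwc : Continuous w) (hwc' : Continuous w')
    (hw : ∀ r, HasDerivAt w (w' r) r) (hwR : w R = 0) {x : ℝ} (hx : x ∈ Icc 0 R) :
    (x * w x) ^ 2 ≤ ∫ r in (0:ℝ)..R, (2 * w r + r * w' r) ^ 2 * r := by
  rw [hardy_id hwc hwc' hw hwR, ← hardy_eq hwc hwc' hw x]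
  have h1 : ∫ r in (0:ℝ)..x, 2 * r * (w r * (w r + r * w' r)) ≤ ∫ r in (0:ℝ)..x, ((w r + r * w' r) ^ 2 + w r ^ 2) * r := by
    refine intervalIntegral.integral_mono_on hx.1 ?_ ?_ ?_
    · exact Continuous.intervalIntegrable (by fun_prop) _ _
    · exact Continuous.intervalIntegrable (by fun_prop) _ _
    · intro s hs
      nlinarith [mul_nonneg hs.1 (sq_nonneg (w s + s * w' s - w s))]
  refine h1.trans (sub_int (Continuous.continuousOn (by fun_prop)) ?_ le_rfl hx.1 hx.2)
  intro s hs
  exact mul_nonneg (by positivity) hs.1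

lemma hardy_two (hR : 0 ≤ R) (hwc : Continuous w) (hwc' : Continuous w')
    (hw : ∀ r, HasDerivAt w (w' r) r) (hwR : w R = 0) :
    ∫ r in (0:ℝ)..R, w r ^ 2 * r ≤ ∫ r in (0:ℝ)..R, (2 * w r + r * w' r) ^ 2 * r := by
  rw [hardy_id hwc hwc' hw hwR]
  refine intervalIntegral.integral_mono_on hR ?_ ?_ ?_
  · exact Continuous.intervalIntegrable (by fun_prop) _ _
  · exact Continuous.intervalIntegrable (by fun_prop) _ _
  · intro s hs
    nlinarith [mul_nonneg hs.1 (sq_nonneg (w s + s * w' s))]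
end hardy

section interp
variable {R rs : ℝ} {G G' D : ℝ → ℝ}

lemma osc_sq (hGc : Continuous G) (hGc' : Continuous G')
    (hG : ∀ r ∈ Icc 0 R, HasDerivAt G (G' r) r) {x y : ℝ} (hx : 0 ≤ x) (hxy : x ≤ y) (hy : y ≤ R) :
    |G y ^ 2 - G x ^ 2| * x ≤ 2 * (√(∫ r in (0:ℝ)..R, G r ^ 2 * r) * √(∫ r in (0:ℝ)..R, G' r ^ 2 * r)) := by
  have h1 : ∫ s in x..y, 2 * (G s * G' s) = G y ^ 2 - G x ^ 2 := by
    refine intervalIntegral.integral_eq_sub_of_hasDerivAt (f := fun s => G s ^ 2) ?_ ?_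
    · intro s hs
      rw [uIcc_of_le hxy] at hs
      refine ((hG s ⟨hx.trans hs.1, hs.2.trans hy⟩).pow 2).congr_deriv ?_
      simp; ring
    · exact Continuous.intervalIntegrable (by fun_prop) _ _
  have h2 : |G y ^ 2 - G x ^ 2| * x ≤ ∫ s in x..y, 2 * (|G s| * |G' s| * s) := by
    rw [← h1]
    calc |∫ s in x..y, 2 * (G s * G' s)| * x ≤ (∫ s in x..y, |2 * (G s * G' s)|) * x := by
          gcongr
          exact intervalIntegral.abs_integral_le_integral_abs hxy
      _ = ∫ s in x..y, |2 * (G s * G' s)| * x := by rw [intervalIntegral.integral_mul_const]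
      _ ≤ _ := by
        refine intervalIntegral.integral_mono_on hxy ?_ ?_ ?_
        · exact Continuous.intervalIntegrable (by fun_prop) _ _
        · exact Continuous.intervalIntegrable (by fun_prop) _ _
        · intro s hs
          rw [abs_mul, abs_mul, abs_two]
          have : 0 ≤ |G s| * |G' s| := by positivity
          nlinarith [hs.1]
  have h3 : ∫ s in x..y, 2 * (|G s| * |G' s| * s) ≤ ∫ s in (0:ℝ)..R, 2 * (|G s| * |G' s| * s) := by
    refine sub_int (Continuous.continuousOn (by fun_prop)) ?_ hx hxy hy
    intro s hs
    have := hs.1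
    positivity
  have h4 := cs_int' (hx.trans (hxy.trans hy)) (f := fun s => |G s|) (g := fun s => |G' s|) (k := fun s => s)
    (by fun_prop) (by fun_prop) (by fun_prop) (fun s hs => hs.1)
  simp only [sq_abs] at h4
  rw [intervalIntegral.integral_const_mul (a := 0)] at h3
  linarith [le_abs_self (∫ s in (0:ℝ)..R, |G s| * |G' s| * s)]

lemma strauss (hR : 0 < R) (hGc : Continuous G) (hGc' : Continuous G')
    (hG : ∀ r ∈ Icc 0 R, HasDerivAt G (G' r) r) (hrs : rs ∈ Icc (R / 2) R) (h0 : G rs = 0)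
    {r : ℝ} (hr : r ∈ Icc 0 R) :
    G r ^ 2 * r ≤ 4 * (√(∫ r in (0:ℝ)..R, G r ^ 2 * r) * √(∫ r in (0:ℝ)..R, G' r ^ 2 * r)) := by
  have hp : 0 ≤ √(∫ r in (0:ℝ)..R, G r ^ 2 * r) * √(∫ r in (0:ℝ)..R, G' r ^ 2 * r) := by positivity
  rcases le_total r rs with h | h
  · have := osc_sq hGc hGc' hG hr.1 h hrs.2
    rw [h0] at this
    have e : |(0:ℝ) ^ 2 - G r ^ 2| = G r ^ 2 := by rw [abs_sub_comm]; simp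
    rw [e] at this
    linarith
  · have := osc_sq hGc hGc' hG (by linarith [hrs.1]) h hr.2
    rw [h0] at this
    have e : |G r ^ 2 - (0:ℝ) ^ 2| = G r ^ 2 := by simp
    rw [e] at this
    have h2 : r ≤ 2 * rs := by linarith [hrs.1, hr.2]
    nlinarith [sq_nonneg (G r)]

lemma osc_log (hGc : Continuous G) (hGc' : Continuous G')
    (hG : ∀ r ∈ Icc 0 R, HasDerivAt G (G' r) r) {x y : ℝ} (hx : 0 < x) (hxy : x ≤ y) (hy : y ≤ R) :
    (G y - G x) ^ 2 ≤ (∫ r in (0:ℝ)..R, G' r ^ 2 * r) * Real.log (y / x) := by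
  have h1 : ∫ s in x..y, G' s = G y - G x := by
    refine intervalIntegral.integral_eq_sub_of_hasDerivAt ?_ ?_
    · intro s hs
      rw [uIcc_of_le hxy] at hs
      exact hG s ⟨hx.le.trans hs.1, hs.2.trans hy⟩
    · exact Continuous.intervalIntegrable (by fun_prop) _ _
  have hne : ∀ s ∈ Icc x y, s ≠ 0 := fun s hs => (hx.trans_le hs.1).ne'
  have h2 := cs_int hxy (f := G') (g := fun s => s⁻¹) (k := fun s => s)
    (by fun_prop) (by fun_prop (disch := assumption)) (by fun_prop) (fun s hs => (hx.trans_le hs.1).le)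
  have e1 : ∫ s in x..y, G' s * s⁻¹ * s = G y - G x := by
    rw [← h1]
    refine intervalIntegral.integral_congr fun s hs => ?_
    rw [uIcc_of_le hxy] at hs
    rw [mul_assoc, inv_mul_cancel₀ (hne s hs), mul_one]
  have e2 : ∫ s in x..y, (s⁻¹) ^ 2 * s = Real.log (y / x) := by
    rw [← integral_inv_of_pos hx (hx.trans_le hxy)]
    refine intervalIntegral.integral_congr fun s hs => ?_
    rw [uIcc_of_le hxy] at hs
    have := hne s hs
    field_simp
  rw [e1, e2] at h2
  refine h2.trans ?_
  have h3 : ∫ s in x..y, G' s ^ 2 * s ≤ ∫ s in (0:ℝ)..R, G' s ^ 2 * s := by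
    refine sub_int (Continuous.continuousOn (by fun_prop)) ?_ hx.le hxy hy
    intro s hs
    have := hs.1
    positivity
  have h4 : 0 ≤ Real.log (y / x) := Real.log_nonneg (by rwa [one_le_div hx])
  gcongr

lemma int_sq (hR : 0 < R) (hGc : Continuous G) (hGc' : Continuous G')
    (hG : ∀ r ∈ Icc 0 R, HasDerivAt G (G' r) r) (hrs : rs ∈ Icc (R / 2) R) (h0 : G rs = 0) :
    ∫ r in (0:ℝ)..R, G r ^ 2 ≤ 6 * (√(∫ r in (0:ℝ)..R, G r ^ 2 * r) * √(∫ r in (0:ℝ)..R, G' r ^ 2 * r)) := by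
  have h1 : ∫ s in (0:ℝ)..R, (G s ^ 2 + 2 * (G s * G' s * s)) = G R ^ 2 * R := by
    have := intervalIntegral.integral_eq_sub_of_hasDerivAt (a := 0) (b := R) (f := fun s => G s ^ 2 * s)
      (f' := fun s => (G s ^ 2 + 2 * (G s * G' s * s))) ?_ ?_
    · rw [this]; simp
    · intro s hs
      rw [uIcc_of_le hR.le] at hs
      refine (((hG s hs).pow 2).mul (hasDerivAt_id s)).congr_deriv ?_
      simp; ring
    · exact Continuous.intervalIntegrable (by fun_prop) _ _
  rw [intervalIntegral.integral_add, intervalIntegral.integral_const_mul] at h1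
  rotate_left
  · exact Continuous.intervalIntegrable (by fun_prop) _ _
  · exact Continuous.intervalIntegrable (by fun_prop) _ _
  have h2 := strauss hR hGc hGc' hG hrs h0 (right_mem_Icc.2 hR.le)
  have h4 := cs_int' hR.le (f := G) (g := G') (k := fun s => s)
    (by fun_prop) (by fun_prop) (by fun_prop) (fun s hs => hs.1)
  have := (abs_le.1 h4).1
  linarith

lemma interp_pt (hR : 0 < R) (hGc : Continuous G) (hGc' : Continuous G')
    (hG : ∀ r ∈ Icc 0 R, HasDerivAt G (G' r) r) (hrs : rs ∈ Icc (R / 2) R) (h0 : G rs = 0)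
    {A N δ : ℝ} (hA : A = ∫ r in (0:ℝ)..R, G r ^ 2 * r) (hN : N = ∫ r in (0:ℝ)..R, G' r ^ 2 * r)
    (hA0 : 0 < A) (hN0 : 0 < N) (hδ : 0 < δ) (hδ' : δ < 1 / 2)
    {r : ℝ} (hr : r ∈ Ioc 0 R) :
    |G r| ≤ √((8 + 1 / δ) * N) * (√(A / N) / r) ^ δ := by
  set r1 := √(A / N) with hr1
  have hr1p : 0 < r1 := Real.sqrt_pos.2 (by positivity)
  have hAN : √A * √N = N * r1 := by
    rw [hr1, Real.sqrt_div hA0.le]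
    have : √N * √N = N := Real.mul_self_sqrt hN0.le
    have h' : 0 < √N := Real.sqrt_pos.2 hN0
    field_simp
    nlinarith
  have hrp := hr.1
  have hst : ∀ x ∈ Icc 0 R, G x ^ 2 * x ≤ 4 * (N * r1) := by
    intro x hx
    have := strauss hR hGc hGc' hG hrs h0 hx
    rwa [← hA, ← hN, hAN] at this
  have hosc : ∀ x y, 0 < x → x ≤ y → y ≤ R → (G y - G x) ^ 2 ≤ N * Real.log (y / x) := by
    intro x y hx hxy hy
    rw [hN]; exact osc_log hGc hGc' hG hx hxy hy
  set X := (r1 / r) ^ (2 * δ) with hX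
  have hXp : 0 < X := by positivity
  have hXd : 0 < X / δ := by positivity
  suffices h : G r ^ 2 ≤ (8 + 1 / δ) * N * X by
    have e : √((8 + 1 / δ) * N) * (r1 / r) ^ δ = √((8 + 1 / δ) * N * X) := by
      rw [Real.sqrt_mul (by positivity) X, hX, Real.sqrt_eq_rpow ((r1 / r) ^ (2 * δ)), ← Real.rpow_mul (by positivity)]
      congr 2; ring
    rw [e]
    exact Real.abs_le_sqrt h
  have hlog : r ≤ r1 → Real.log (r1 / r) ≤ X / (2 * δ) := by
    intro h
    exact Real.log_le_rpow_div (by positivity) (by positivity)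
  have e0 : (8 + 1 / δ) * N * X = N * (8 * X + X / δ) := by ring
  have e1 : X / (2 * δ) = (X / δ) / 2 := by field_simp
  rw [e0]
  rcases le_total r1 r with h | h
  · have h1 := hst r ⟨hr.1.le, hr.2⟩
    have h2 : G r ^ 2 ≤ 4 * N * (r1 / r) := by
      rw [← mul_div_assoc, le_div_iff₀ hrp]; linarith
    have h3 : r1 / r ≤ X := by
      have : (r1 / r) ^ (1:ℝ) ≤ (r1 / r) ^ (2 * δ) :=
        Real.rpow_le_rpow_of_exponent_ge (by positivity) (by rwa [div_le_one hrp]) (by linarith)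
      simpa using this
    have : N * (r1 / r) ≤ N * X := by gcongr
    nlinarith [mul_pos hN0 hXp, mul_pos hN0 hXd]
  · have hX1 : 1 ≤ X := Real.one_le_rpow (by rwa [one_le_div hrp]) (by positivity)
    have hl := hlog h
    rcases le_total r1 R with h' | h'
    · have h1 := hst r1 ⟨hr1p.le, h'⟩
      have h1' : G r1 ^ 2 ≤ 4 * N := by
        by_contra hc
        push Not at hc
        nlinarith
      have h2 := hosc r r1 hrp h h'
      have h3 : N * Real.log (r1 / r) ≤ N * (X / (2 * δ)) := by gcongr
      rw [e1] at h3
      have h4 : G r ^ 2 ≤ 2 * G r1 ^ 2 + 2 * (G r1 - G r) ^ 2 := by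
        nlinarith [sq_nonneg (2 * G r1 - G r)]
      nlinarith
    · rcases le_total r rs with h2 | h2
      · have h3 := hosc r rs hrp h2 hrs.2
        rw [h0] at h3
        have h4 : Real.log (rs / r) ≤ Real.log (r1 / r) := by
          have : 0 < rs := hrp.trans_le h2
          gcongr
          linarith [hrs.2]
        have h5 : N * Real.log (rs / r) ≤ N * (X / (2 * δ)) := by gcongr; linarith
        rw [e1] at h5
        nlinarith [mul_pos hN0 hXp, mul_pos hN0 hXd]
      · have hrsp : 0 < rs := by linarith [hrs.1]
        have h3 := hosc rs r hrsp h2 hr.2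
        rw [h0] at h3
        have h4 : Real.log (r / rs) ≤ r / rs - 1 := Real.log_le_sub_one_of_pos (by positivity)
        have h5 : r / rs ≤ 2 := by
          rw [div_le_iff₀ hrsp]; linarith [hrs.1, hr.2]
        have h6 : N * Real.log (r / rs) ≤ N * X := by gcongr; linarith
        nlinarith [mul_pos hN0 hXp, mul_pos hN0 hXd]

lemma poinc (hR : 0 < R) (hGc : Continuous G) (hGc' : Continuous G')
    (hG : ∀ r ∈ Icc 0 R, HasDerivAt G (G' r) r) (hrs : rs ∈ Icc (R / 2) R) (h0 : G rs = 0) :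
    √(∫ r in (0:ℝ)..R, G r ^ 2 * r) ≤ 4 * R * √(∫ r in (0:ℝ)..R, G' r ^ 2 * r) := by
  have hA : 0 ≤ ∫ r in (0:ℝ)..R, G r ^ 2 * r :=
    intervalIntegral.integral_nonneg hR.le fun x hx => mul_nonneg (sq_nonneg _) hx.1
  have h1 : ∫ r in (0:ℝ)..R, G r ^ 2 * r ≤
      R * (4 * (√(∫ r in (0:ℝ)..R, G r ^ 2 * r) * √(∫ r in (0:ℝ)..R, G' r ^ 2 * r))) := by
    have : ∫ r in (0:ℝ)..R, G r ^ 2 * r ≤ ∫ _ in (0:ℝ)..R, 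
      (4 * (√(∫ r in (0:ℝ)..R, G r ^ 2 * r) * √(∫ r in (0:ℝ)..R, G' r ^ 2 * r))) := by
      refine intervalIntegral.integral_mono_on hR.le ?_ ?_ ?_
      · exact Continuous.intervalIntegrable (by fun_prop) _ _
      · exact Continuous.intervalIntegrable (by fun_prop) _ _
      · intro s hs
        exact strauss hR hGc hGc' hG hrs h0 hs
    rw [intervalIntegral.integral_const] at this
    simpa only [sub_zero, smul_eq_mul] using this
  set a := √(∫ r in (0:ℝ)..R, G r ^ 2 * r) with ha
  have h2 : a * a = ∫ r in (0:ℝ)..R, G r ^ 2 * r := Real.mul_self_sqrt hA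
  rw [← h2] at h1
  have ha0 : 0 ≤ a := Real.sqrt_nonneg _
  rcases ha0.eq_or_lt with h | h
  · rw [← h]; positivity
  · by_contra hc
    push Not at hc
    nlinarith

lemma interp_main (hR : 0 < R) (hGc : Continuous G) (hGc' : Continuous G') (hDc : Continuous D)
    (hG : ∀ r ∈ Icc 0 R, HasDerivAt G (G' r) r) (hrs : rs ∈ Icc (R / 2) R) (h0 : G rs = 0)
    {A N d δ κ k L : ℝ} (hA : A = ∫ r in (0:ℝ)..R, G r ^ 2 * r) (hN : N = ∫ r in (0:ℝ)..R, G' r ^ 2 * r)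
    (hd : d = ∫ r in (0:ℝ)..R, D r ^ 2 * r)
    (hδ : 0 < δ) (hδ' : δ < 1 / 2) (hκ : 0 < κ) (hk : 0 < k) (hL : 0 ≤ L)
    (hDG : ∀ r ∈ Icc 0 R, |D r| ≤ k * (|G r| + L)) :
    ∫ r in (0:ℝ)..R, |G r| * D r ^ 2 * r ≤
      √((8 + 1 / δ) * N) * κ ^ (-δ) * d
      + k * √((8 + 1 / δ) * N) * κ ^ (1 / 2 - δ) * (√6 * √A * √d)
      + k * L * (√A * √d) := by
  have hA0 : 0 ≤ A := by
    rw [hA]; exact intervalIntegral.integral_nonneg hR.le fun x hx => mul_nonneg (sq_nonneg _) hx.1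
  have hN0 : 0 ≤ N := by
    rw [hN]; exact intervalIntegral.integral_nonneg hR.le fun x hx => mul_nonneg (sq_nonneg _) hx.1
  have hd0 : 0 ≤ d := by
    rw [hd]; exact intervalIntegral.integral_nonneg hR.le fun x hx => mul_nonneg (sq_nonneg _) hx.1
  by_cases hdeg : √A * √N = 0
  · have hz : ∫ r in (0:ℝ)..R, |G r| * D r ^ 2 * r = ∫ r in (0:ℝ)..R, 0 := by
      refine intervalIntegral.integral_congr fun r hr => ?_
      rw [uIcc_of_le hR.le] at hr
      have := strauss hR hGc hGc' hG hrs h0 hr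
      rw [← hA, ← hN, hdeg, mul_zero] at this
      rcases hr.1.eq_or_lt with h | h
      · rw [← h]; ring
      · have h2 : G r ^ 2 ≤ 0 := by
          by_contra hc
          push Not at hc
          nlinarith
        have : G r = 0 := by
          have := le_antisymm h2 (sq_nonneg _)
          simpa using this
        rw [this]; simp
    rw [hz, intervalIntegral.integral_zero]
    positivity
  have hA1 : 0 < A := by
    rcases hA0.eq_or_lt with h | h
    · rw [← h] at hdeg; simp at hdeg
    · exact h
  have hN1 : 0 < N := by
    rcases hN0.eq_or_lt with h | h
    · rw [← h] at hdeg; simp at hdeg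
    · exact h
  set r1 := √(A / N) with hr1
  have hr1p : 0 < r1 := Real.sqrt_pos.2 (by positivity)
  set y := √((8 + 1 / δ) * N) with hy
  have hy0 : 0 ≤ y := Real.sqrt_nonneg _
  have hpt : ∀ r ∈ Icc 0 R, |G r| * D r ^ 2 * r ≤ y * κ ^ (-δ) * (D r ^ 2 * r)
      + k * y * κ ^ (1 / 2 - δ) * √r1 * ((√r * |D r|) * |G r| * 1) + k * L * (|G r| * |D r| * r) := by
    intro r hr
    rcases hr.1.eq_or_lt with h | hrp
    · rw [← h]; simp
    have hgb : |G r| ≤ y * (r1 / r) ^ δ :=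
      interp_pt hR hGc hGc' hG hrs h0 hA hN hA1 hN1 hδ hδ' ⟨hrp, hr.2⟩
    have hDr := hDG r hr
    set g := |G r| with hg
    have hg0 : 0 ≤ g := abs_nonneg _
    have hD2 : D r ^ 2 = |D r| ^ 2 := (sq_abs _).symm
    rw [hD2]
    set e := |D r| with he
    have he0 : 0 ≤ e := abs_nonneg _
    have hκp : 0 < κ ^ (-δ) := by positivity
    have hκq : 0 < κ ^ (1 / 2 - δ) := by positivity
    rcases le_total (κ * r1) r with h | h
    · have h1 : (r1 / r) ^ δ ≤ κ ^ (-δ) := by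
        rw [Real.rpow_neg hκ.le, ← Real.inv_rpow hκ.le]
        refine Real.rpow_le_rpow (by positivity) ?_ hδ.le
        rw [div_le_iff₀ hrp]
        field_simp
        linarith
      have h2 : g ≤ y * κ ^ (-δ) := hgb.trans (by gcongr)
      have h3 : g * e ^ 2 * r ≤ y * κ ^ (-δ) * (e ^ 2 * r) := by
        have : 0 ≤ e ^ 2 * r := by positivity
        nlinarith
      have : 0 ≤ k * y * κ ^ (1 / 2 - δ) * √r1 * ((√r * e) * g * 1) + k * L * (g * e * r) := by positivity
      linarith
    · have h1 : (r1 / r) ^ δ ≤ (√r1 / √r) * κ ^ (1 / 2 - δ) := by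
        have e1 : (√r1 / √r) = (r1 / r) ^ (1 / 2 : ℝ) := by
          rw [← Real.sqrt_div hr1p.le, Real.sqrt_eq_rpow]
        have e2 : (r1 / r) ^ δ = (r1 / r) ^ (1 / 2 : ℝ) * ((r1 / r)⁻¹) ^ (1 / 2 - δ) := by
          rw [Real.inv_rpow (by positivity), ← Real.rpow_neg (by positivity), ← Real.rpow_add (by positivity)]
          congr 1; ring
        rw [e1, e2]
        refine mul_le_mul_of_nonneg_left (Real.rpow_le_rpow (by positivity) ?_ (by linarith)) (by positivity)
        rw [inv_div, div_le_iff₀ hr1p]; exact h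
      have h2 : g * r ≤ y * κ ^ (1 / 2 - δ) * √r1 * √r := by
        calc g * r ≤ (y * ((√r1 / √r) * κ ^ (1 / 2 - δ))) * r := by
              gcongr
              exact hgb.trans (by gcongr)
          _ = y * κ ^ (1 / 2 - δ) * √r1 * (r / √r) := by ring
          _ = _ := by rw [Real.div_sqrt]
      have h3 : g * e ^ 2 * r ≤ g * e * r * (k * (g + L)) := by
        have : 0 ≤ g * e * r := by positivity
        nlinarith
      have h4 : (k * g * e) * (g * r) ≤ (k * g * e) * (y * κ ^ (1 / 2 - δ) * √r1 * √r) := by gcongr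
      have : 0 ≤ y * κ ^ (-δ) * (e ^ 2 * r) := by positivity
      nlinarith
  have hcs1 := cs_int' hR.le (f := fun r => √r * |D r|) (g := fun r => |G r|) (k := fun _ => 1)
    (by fun_prop) (by fun_prop) (by fun_prop) (fun _ _ => zero_le_one)
  have hcs2 := cs_int' hR.le (f := fun r => |G r|) (g := fun r => |D r|) (k := fun r => r)
    (by fun_prop) (by fun_prop) (by fun_prop) (fun s hs => hs.1)
  have e1 : ∫ r in (0:ℝ)..R, (√r * |D r|) ^ 2 * 1 = d := by
    rw [hd]
    refine intervalIntegral.integral_congr fun r hr => ?_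
    rw [uIcc_of_le hR.le] at hr
    rw [mul_pow, Real.sq_sqrt hr.1, sq_abs]; ring
  have e2 : ∫ r in (0:ℝ)..R, |G r| ^ 2 * 1 = ∫ r in (0:ℝ)..R, G r ^ 2 := by
    refine intervalIntegral.integral_congr fun r hr => ?_
    simp
  simp only [sq_abs] at hcs2
  rw [← hA, ← hd] at hcs2
  rw [e1, e2] at hcs1
  have h6 := int_sq hR hGc hGc' hG hrs h0
  rw [← hA, ← hN] at h6
  have h7 : √r1 * √(∫ r in (0:ℝ)..R, G r ^ 2) ≤ √6 * √A := by
    rw [← Real.sqrt_mul hr1p.le, ← Real.sqrt_mul (by norm_num)]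
    refine Real.sqrt_le_sqrt ?_
    have : r1 * (√A * √N) = A := by
      rw [hr1, Real.sqrt_div hA0]
      have h' : 0 < √N := Real.sqrt_pos.2 hN1
      field_simp
      exact Real.sq_sqrt hA0
    nlinarith
  have hII := intervalIntegral.integral_mono_on (μ := volume) hR.le
    (Continuous.intervalIntegrable (by fun_prop) _ _)
    (Continuous.intervalIntegrable (by fun_prop) _ _) hpt
  rw [intervalIntegral.integral_add, intervalIntegral.integral_add,
    intervalIntegral.integral_const_mul, intervalIntegral.integral_const_mul,
    intervalIntegral.integral_const_mul, ← hd] at hII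
  rotate_left
  · exact Continuous.intervalIntegrable (by fun_prop) _ _
  · exact Continuous.intervalIntegrable (by fun_prop) _ _
  · exact Continuous.intervalIntegrable (by fun_prop) _ _
  · exact Continuous.intervalIntegrable (by fun_prop) _ _
  refine hII.trans ?_
  have h8 : k * y * κ ^ (1 / 2 - δ) * √r1 * ∫ r in (0:ℝ)..R, (√r * |D r|) * |G r| * 1
      ≤ k * y * κ ^ (1 / 2 - δ) * (√6 * √A * √d) := by
    have h9 : √r1 * ∫ r in (0:ℝ)..R, (√r * |D r|) * |G r| * 1 ≤ √6 * √A * √d := by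
      calc √r1 * ∫ r in (0:ℝ)..R, (√r * |D r|) * |G r| * 1 
          ≤ √r1 * (√d * √(∫ r in (0:ℝ)..R, G r ^ 2)) := by
            gcongr; exact (le_abs_self _).trans hcs1
        _ = (√r1 * √(∫ r in (0:ℝ)..R, G r ^ 2)) * √d := by ring
        _ ≤ _ := by gcongr
    calc _ = k * y * κ ^ (1 / 2 - δ) * (√r1 * ∫ r in (0:ℝ)..R, (√r * |D r|) * |G r| * 1) := by ring
      _ ≤ _ := by gcongr
  have h10 : k * L * ∫ r in (0:ℝ)..R, |G r| * |D r| * r ≤ k * L * (√A * √d) := by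
    gcongr; exact (le_abs_self _).trans hcs2
  linarith
end interp
end
end

section
open MeasureTheory Set Filter
open scoped Topology ContDiff
noncomputable section

lemma rstar {μ β γ R E X : ℝ} (hμ : 0 < μ) (hβ : 1 < β) (hγ : 1 < γ) (hR : 0 < R) (hE : 0 < E)
    {p F : ℝ → ℝ} (hpc : Continuous p) (hFc : Continuous F) (hp : ∀ r ∈ Icc 0 R, 0 < p r)
    (hPE : ∫ r in (0:ℝ)..R, p r ^ γ * r ≤ E)
    (hX : X = ∫ r in (0:ℝ)..R, F r ^ 2 / (2 * μ + p r ^ β) * r) :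
    ∃ rs ∈ Icc (R / 2) R, F rs ^ 2 ≤ (2 * μ + (16 * E / (3 * R ^ 2)) ^ (β / γ)) * (16 / (3 * R ^ 2)) * X := by
  have hcβ : Continuous fun r => p r ^ β := hpc.rpow_const (fun _ => Or.inr (by linarith))
  have hcγ : Continuous fun r => p r ^ γ := hpc.rpow_const (fun _ => Or.inr (by linarith))
  have hQ : ∀ r ∈ Icc 0 R, 0 < 2 * μ + p r ^ β := fun r hr => by
    have := hp r hr
    positivity
  have hv : ContinuousOn (fun r => F r ^ 2 / (2 * μ + p r ^ β)) (Icc 0 R) :=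
    ContinuousOn.div (by fun_prop) (Continuous.continuousOn (by fun_prop)) (fun r hr => (hQ r hr).ne')
  set h : ℝ → ℝ := fun r => F r ^ 2 / (2 * μ + p r ^ β) * E + p r ^ γ * X with hh
  have hhc : ContinuousOn h (Icc 0 R) :=
    (hv.mul continuousOn_const).add (Continuous.continuousOn (by fun_prop))
  have hX0 : 0 ≤ X := by
    rw [hX]
    refine intervalIntegral.integral_nonneg hR.le fun r hr => ?_
    have := hQ r hr
    have := hr.1
    positivity
  obtain ⟨rs, hrs, hmin⟩ := (isCompact_Icc (a := R / 2) (b := R)).exists_isMinOn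
    ⟨R, by constructor <;> linarith⟩ (hhc.mono (Icc_subset_Icc (by linarith) le_rfl))
  have hrs0 : rs ∈ Icc 0 R := ⟨by linarith [hrs.1], hrs.2⟩
  refine ⟨rs, hrs, ?_⟩
  have h1 : ∫ r in (R/2)..R, h rs * r ≤ ∫ r in (R/2)..R, h r * r := by
    refine intervalIntegral.integral_mono_on (by linarith) ?_ ?_ ?_
    · exact Continuous.intervalIntegrable (by fun_prop) _ _
    · refine ContinuousOn.intervalIntegrable ?_
      rw [uIcc_of_le (by linarith)]
      exact (hhc.mono (Icc_subset_Icc (by linarith) le_rfl)).mul (by fun_prop)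
    · intro r hr
      have : h rs ≤ h r := hmin hr
      have : 0 ≤ r := by linarith [hr.1]
      gcongr
  have h2 : ∫ r in (R/2)..R, h r * r ≤ ∫ r in (0:ℝ)..R, h r * r := by
    refine sub_int (hhc.mul (by fun_prop)) ?_ (by linarith) (by linarith) le_rfl
    intro r hr
    have := hQ r hr
    have := hr.1
    have := hp r hr
    simp only [hh]
    positivity
  have h3 : ∫ r in (0:ℝ)..R, h r * r ≤ 2 * E * X := by
    have e : ∫ r in (0:ℝ)..R, h r * r = (∫ r in (0:ℝ)..R, F r ^ 2 / (2 * μ + p r ^ β) * r) * E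
        + (∫ r in (0:ℝ)..R, p r ^ γ * r) * X := by
      rw [← intervalIntegral.integral_mul_const, ← intervalIntegral.integral_mul_const,
        ← intervalIntegral.integral_add]
      · refine intervalIntegral.integral_congr fun r _ => ?_
        simp only [hh]; ring
      · refine ContinuousOn.intervalIntegrable ?_
        rw [uIcc_of_le hR.le]
        fun_prop
      · exact Continuous.intervalIntegrable (by fun_prop) _ _
    rw [e, ← hX]
    nlinarith
  have h4 : ∫ r in (R/2)..R, h rs * r = h rs * (3 * R ^ 2 / 8) := by
    rw [intervalIntegral.integral_const_mul, integral_id]; ring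
  have h5 : h rs * (3 * R ^ 2 / 8) ≤ 2 * E * X := by linarith
  have h6 : h rs ≤ E * (16 / (3 * R ^ 2)) * X := by
    have : h rs ≤ 2 * E * X / (3 * R ^ 2 / 8) := by rwa [le_div_iff₀ (by positivity)]
    refine this.trans (le_of_eq ?_)
    field_simp; ring
  have hp0 := hp rs hrs0
  have hQ0 := hQ rs hrs0
  have hPp : 0 < p rs ^ γ := by positivity
  have h7 : F rs ^ 2 / (2 * μ + p rs ^ β) ≤ (16 / (3 * R ^ 2)) * X := by
    have : F rs ^ 2 / (2 * μ + p rs ^ β) * E ≤ E * (16 / (3 * R ^ 2)) * X := by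
      have : 0 ≤ p rs ^ γ * X := by positivity
      simp only [hh] at h6
      linarith
    by_contra hc
    push Not at hc
    nlinarith
  rw [div_le_iff₀ hQ0] at h7
  rcases hX0.eq_or_lt with h0 | h0
  · rw [← h0] at h7 ⊢
    linarith
  · have h8 : p rs ^ γ ≤ 16 * E / (3 * R ^ 2) := by
      have : p rs ^ γ * X ≤ E * (16 / (3 * R ^ 2)) * X := by
        have : 0 ≤ F rs ^ 2 / (2 * μ + p rs ^ β) * E := by positivity
        simp only [hh] at h6
        linarith
      have := le_of_mul_le_mul_right this h0
      refine this.trans (le_of_eq ?_)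
      ring
    have h9 : p rs ^ β ≤ (16 * E / (3 * R ^ 2)) ^ (β / γ) := by
      calc p rs ^ β = (p rs ^ γ) ^ (β / γ) := by
            rw [← Real.rpow_mul hp0.le]; congr 1; field_simp
        _ ≤ _ := Real.rpow_le_rpow (by positivity) h8 (by positivity)
    calc F rs ^ 2 ≤ 16 / (3 * R ^ 2) * X * (2 * μ + p rs ^ β) := h7
      _ ≤ 16 / (3 * R ^ 2) * X * (2 * μ + (16 * E / (3 * R ^ 2)) ^ (β / γ)) := by gcongr
      _ = _ := by ring

/-- lower bound for the modified energy -/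
lemma Y_bound {μ β γ R M : ℝ} (hμ : 0 < μ) (hβ : 1 < β) (hγ : 1 < γ) (hR : 0 < R)
    {p D : ℝ → ℝ} (hpc : Continuous p) (hDc : Continuous D) (hp : ∀ r ∈ Icc 0 R, 0 < p r)
    (hpM : ∀ r ∈ Icc 0 R, p r ≤ M) :
    |∫ r in (0:ℝ)..R, p r ^ γ * D r * r| ≤ (∫ r in (0:ℝ)..R, (2 * μ + p r ^ β) * D r ^ 2 * r) / 4
      + R ^ 2 / (4 * μ) * M ^ (2 * γ) := by
  have hcβ : Continuous fun r => p r ^ β := hpc.rpow_const (fun _ => Or.inr (by linarith))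
  have hcγ : Continuous fun r => p r ^ γ := hpc.rpow_const (fun _ => Or.inr (by linarith))
  have h1 : |∫ r in (0:ℝ)..R, p r ^ γ * D r * r| ≤ ∫ r in (0:ℝ)..R, |p r ^ γ * D r * r| :=
    intervalIntegral.abs_integral_le_integral_abs hR.le
  have h2 : ∫ r in (0:ℝ)..R, |p r ^ γ * D r * r| ≤
      ∫ r in (0:ℝ)..R, ((1 / 4) * ((2 * μ + p r ^ β) * D r ^ 2 * r) + M ^ (2 * γ) / (2 * μ) * r) := by
    refine intervalIntegral.integral_mono_on hR.le ?_ ?_ ?_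
    · exact Continuous.intervalIntegrable (by fun_prop) _ _
    · exact Continuous.intervalIntegrable (by fun_prop) _ _
    · intro r hr
      have hr0 := hr.1
      have hp0 := hp r hr
      have hb : 0 < p r ^ β := by positivity
      have hg : 0 < p r ^ γ := by positivity
      have hM : (p r ^ γ) ^ 2 ≤ M ^ (2 * γ) := by
        calc (p r ^ γ) ^ 2 = p r ^ (2 * γ) := by
              rw [← Real.rpow_natCast, ← Real.rpow_mul hp0.le]; congr 1; push_cast; ring
          _ ≤ _ := Real.rpow_le_rpow hp0.le (hpM r hr) (by linarith)
      rw [abs_mul, abs_mul, abs_of_nonneg hr0, abs_of_pos hg]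
      have : p r ^ γ * |D r| ≤ (1 / 4) * ((2 * μ + p r ^ β) * D r ^ 2) + M ^ (2 * γ) / (2 * μ) := by
        have e1 : (p r ^ γ) ^ 2 / (2 * μ) ≤ M ^ (2 * γ) / (2 * μ) := by gcongr
        have e2 : p r ^ γ * |D r| ≤ (1 / 4) * (2 * μ * |D r| ^ 2) + (p r ^ γ) ^ 2 / (2 * μ) := by
          have : (1 / 4) * (2 * μ * |D r| ^ 2) + (p r ^ γ) ^ 2 / (2 * μ) - p r ^ γ * |D r|
            = (μ * |D r| - p r ^ γ) ^ 2 / (2 * μ) := by field_simp; ring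
          have h' : 0 ≤ (μ * |D r| - p r ^ γ) ^ 2 / (2 * μ) := by positivity
          linarith
        rw [sq_abs] at e2
        nlinarith [mul_nonneg hb.le (sq_nonneg (D r))]
      calc _ ≤ ((1 / 4) * ((2 * μ + p r ^ β) * D r ^ 2) + M ^ (2 * γ) / (2 * μ)) * r := by gcongr
        _ = _ := by ring
  rw [intervalIntegral.integral_add, intervalIntegral.integral_const_mul,
    intervalIntegral.integral_const_mul, integral_id] at h2
  rotate_left
  · exact Continuous.intervalIntegrable (by fun_prop) _ _
  · exact Continuous.intervalIntegrable (by fun_prop) _ _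
  have e : M ^ (2 * γ) / (2 * μ) * ((R ^ 2 - 0 ^ 2) / 2) = R ^ 2 / (4 * μ) * M ^ (2 * γ) := by
    field_simp; ring
  rw [e] at h2
  linarith

lemma X_bound {μ β γ R M : ℝ} (hμ : 0 < μ) (hβ : 1 < β) (hγ : 1 < γ) (hR : 0 < R)
    {p D F : ℝ → ℝ} (hpc : Continuous p) (hDc : Continuous D) (hp : ∀ r ∈ Icc 0 R, 0 < p r)
    (hpM : ∀ r ∈ Icc 0 R, p r ≤ M) (hF : ∀ r, F r = (2 * μ + p r ^ β) * D r - p r ^ γ) :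
    ∫ r in (0:ℝ)..R, F r ^ 2 / (2 * μ + p r ^ β) * r
      ≤ 2 * (∫ r in (0:ℝ)..R, (2 * μ + p r ^ β) * D r ^ 2 * r)
      + R ^ 2 / (2 * μ) * M ^ (2 * γ) := by
  have hcβ : Continuous fun r => p r ^ β := hpc.rpow_const (fun _ => Or.inr (by linarith))
  have hcγ : Continuous fun r => p r ^ γ := hpc.rpow_const (fun _ => Or.inr (by linarith))
  have hFc : Continuous F := by
    have : F = fun r => (2 * μ + p r ^ β) * D r - p r ^ γ := funext hF
    rw [this]; fun_prop
  have hQ : ∀ r ∈ Icc 0 R, 0 < 2 * μ + p r ^ β := fun r hr => by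
    have := hp r hr
    positivity
  have hv : ContinuousOn (fun r => F r ^ 2 / (2 * μ + p r ^ β)) (Icc 0 R) :=
    ContinuousOn.div (by fun_prop) (Continuous.continuousOn (by fun_prop)) (fun r hr => (hQ r hr).ne')
  have h2 : ∫ r in (0:ℝ)..R, F r ^ 2 / (2 * μ + p r ^ β) * r ≤
      ∫ r in (0:ℝ)..R, (2 * ((2 * μ + p r ^ β) * D r ^ 2 * r) + M ^ (2 * γ) / μ * r) := by
    refine intervalIntegral.integral_mono_on hR.le ?_ ?_ ?_
    · refine ContinuousOn.intervalIntegrable ?_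
      rw [uIcc_of_le hR.le]; fun_prop
    · exact Continuous.intervalIntegrable (by fun_prop) _ _
    · intro r hr
      have hr0 := hr.1
      have hp0 := hp r hr
      have hb : 0 < p r ^ β := by positivity
      have hQ0 := hQ r hr
      have hM : (p r ^ γ) ^ 2 ≤ M ^ (2 * γ) := by
        calc (p r ^ γ) ^ 2 = p r ^ (2 * γ) := by
              rw [← Real.rpow_natCast, ← Real.rpow_mul hp0.le]; congr 1; push_cast; ring
          _ ≤ _ := Real.rpow_le_rpow hp0.le (hpM r hr) (by linarith)
      have h3 : F r ^ 2 / (2 * μ + p r ^ β) ≤ 2 * ((2 * μ + p r ^ β) * D r ^ 2) + M ^ (2 * γ) / μ := by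
        rw [div_le_iff₀ hQ0, hF r]
        have h5 : (p r ^ γ) ^ 2 / μ ≤ M ^ (2 * γ) / μ := by gcongr
        have h4 : 2 * (p r ^ γ) ^ 2 ≤ M ^ (2 * γ) / μ * (2 * μ + p r ^ β) := by
          have e : M ^ (2 * γ) / μ * (2 * μ + p r ^ β) = 2 * M ^ (2 * γ) + M ^ (2 * γ) / μ * p r ^ β := by
            field_simp
          rw [e]
          have : 0 ≤ M ^ (2 * γ) / μ * p r ^ β := by
            have : 0 ≤ M ^ (2 * γ) := (sq_nonneg _).trans hM
            positivity
          linarith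
        nlinarith [sq_nonneg ((2 * μ + p r ^ β) * D r + p r ^ γ)]
      calc _ ≤ (2 * ((2 * μ + p r ^ β) * D r ^ 2) + M ^ (2 * γ) / μ) * r := by gcongr
        _ = _ := by ring
  rw [intervalIntegral.integral_add, intervalIntegral.integral_const_mul,
    intervalIntegral.integral_const_mul, integral_id] at h2
  rotate_left
  · exact Continuous.intervalIntegrable (by fun_prop) _ _
  · exact Continuous.intervalIntegrable (by fun_prop) _ _
  have e : M ^ (2 * γ) / μ * ((R ^ 2 - 0 ^ 2) / 2) = R ^ 2 / (2 * μ) * M ^ (2 * γ) := by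
    field_simp; ring
  rw [e] at h2
  linarith
end
end

section
open MeasureTheory Set Filter
open scoped Topology ContDiff
noncomputable section

lemma pt_bracket {μ β γ q P D F : ℝ} (hμ : 0 < μ) (hβ : 1 < β) (hq : 0 ≤ q) (hP : 0 ≤ P)
    (hF : F = (2 * μ + q) * D - P) :
    1 / 2 * (2 * μ + q - β * q) * D ^ 3 + (γ - 1) * (P * D ^ 2) - F * D ^ 2
      ≤ D ^ 2 * ((1 + β) * |F| + (β + γ) * P) := by
  have h1 : |(2 * μ + q - β * q) * D| ≤ β * (|F| + P) := by
    have e1 : |2 * μ + q - β * q| ≤ β * (2 * μ + q) := by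
      rw [abs_le]; constructor <;> nlinarith
    have e2 : |(2 * μ + q) * D| ≤ |F| + P := by
      have : (2 * μ + q) * D = F + P := by rw [hF]; ring
      rw [this]
      exact (abs_add_le _ _).trans (by rw [abs_of_nonneg hP])
    rw [abs_mul, abs_of_nonneg (by positivity : 0 ≤ 2 * μ + q)] at e2
    rw [abs_mul]
    calc _ ≤ β * (2 * μ + q) * |D| := by gcongr
      _ = β * ((2 * μ + q) * |D|) := by ring
      _ ≤ _ := by gcongr
  have h2 : 1 / 2 * (2 * μ + q - β * q) * D ^ 3 + (γ - 1) * (P * D ^ 2) - F * D ^ 2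
      = D ^ 2 * (1 / 2 * ((2 * μ + q - β * q) * D) + (γ - 1) * P - F) := by ring
  rw [h2]
  refine mul_le_mul_of_nonneg_left ?_ (sq_nonneg D)
  have := le_abs_self ((2 * μ + q - β * q) * D)
  have := neg_abs_le F
  have : 0 ≤ β * (|F| + P) := by positivity
  nlinarith

lemma flux_wr {R : ℝ} {w w' F' : ℝ → ℝ} (hR : 0 < R) (hwc : Continuous w) (hwc' : Continuous w')
    (hw : ∀ r, HasDerivAt w (w' r) r) (hwR : w R = 0) (hF' : Continuous F') :
    |∫ r in (0:ℝ)..R, F' r * (r * w r) ^ 2| ≤ √(∫ r in (0:ℝ)..R, F' r ^ 2 * r) *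
      (∫ r in (0:ℝ)..R, (2 * w r + r * w' r) ^ 2 * r) := by
  set d := ∫ r in (0:ℝ)..R, (2 * w r + r * w' r) ^ 2 * r with hd
  have hd0 : 0 ≤ d := intervalIntegral.integral_nonneg hR.le fun r hr =>
    mul_nonneg (sq_nonneg _) hr.1
  have h1 := cs_int' hR.le hF'.continuousOn (g := fun r => r * w r ^ 2) (k := fun r => r)
    (by fun_prop) (by fun_prop) (fun x hx => hx.1)
  have e : ∫ r in (0:ℝ)..R, F' r * (r * w r) ^ 2 = ∫ r in (0:ℝ)..R, F' r * (r * w r ^ 2) * r :=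
    intervalIntegral.integral_congr fun r _ => by ring
  rw [e]
  refine h1.trans ?_
  refine mul_le_mul_of_nonneg_left ?_ (Real.sqrt_nonneg _)
  refine Real.sqrt_le_iff.2 ⟨hd0, ?_⟩
  calc ∫ r in (0:ℝ)..R, (r * w r ^ 2) ^ 2 * r ≤ ∫ r in (0:ℝ)..R, d * (w r ^ 2 * r) := by
        refine intervalIntegral.integral_mono_on hR.le ?_ ?_ ?_
        · exact Continuous.intervalIntegrable (by fun_prop) _ _
        · exact Continuous.intervalIntegrable (by fun_prop) _ _
        · intro r hr
          have := hardy_sup hwc hwc' hw hwR hr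
          have h3 : 0 ≤ w r ^ 2 * r := mul_nonneg (sq_nonneg _) hr.1
          calc _ = (r * w r) ^ 2 * (w r ^ 2 * r) := by ring
            _ ≤ _ := by gcongr
    _ = d * ∫ r in (0:ℝ)..R, w r ^ 2 * r := by rw [intervalIntegral.integral_const_mul]
    _ ≤ d * d := by gcongr; exact hardy_two hR.le hwc hwc' hw hwR
    _ = d ^ 2 := by ring

/-- the interpolated bound of `∫ |G| D²` in normalized form -/
lemma interp_norm {μ β R α M Y Cc C4 : ℝ} (hμ : 0 < μ) (hβ : 1 < β) (hR : 0 < R) (hα0 : 0 < α)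
    (hα1 : α < 1) (hM : 1 ≤ M) (hY : 1 ≤ Y) (hCc : 0 ≤ Cc) (hC4 : 0 ≤ C4)
    {G G' D : ℝ → ℝ} {rs L A N d : ℝ} (hGc : Continuous G) (hGc' : Continuous G') (hDc : Continuous D)
    (hG : ∀ r ∈ Icc 0 R, HasDerivAt G (G' r) r) (hrs : rs ∈ Icc (R / 2) R) (h0 : G rs = 0)
    (hA : A = ∫ r in (0:ℝ)..R, G r ^ 2 * r) (hN : N = ∫ r in (0:ℝ)..R, G' r ^ 2 * r)
    (hd : d = ∫ r in (0:ℝ)..R, D r ^ 2 * r) (hL : 0 ≤ L)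
    (hDG : ∀ r ∈ Icc 0 R, |D r| ≤ 1 / (2 * μ) * (|G r| + L))
    (hLY : L ≤ Cc * √Y) (hAY : A ≤ C4 * M ^ β * Y) (hdY : d ≤ 2 / μ * Y) :
    ∫ r in (0:ℝ)..R, |G r| * D r ^ 2 * r ≤
      (√(8 + 1 / (α / 2)) * √(2 / μ) + 1 / (2 * μ) * √(8 + 1 / (α / 2)) * √6 * √C4
        + 1 / (2 * μ) * Cc * (4 * R)) * (M ^ (α * β / 2) * (√N * √d * √Y)) := by
  have hM0 : 0 < M := by linarith
  have hY0 : 0 < Y := by linarith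
  have h := interp_main hR hGc hGc' hDc hG hrs h0 hA hN hd (δ := α / 2) (κ := M ^ (-β))
    (k := 1 / (2 * μ)) (by positivity) (by linarith) (by positivity) (by positivity) hL hDG
  have hB : 0 ≤ 8 + 1 / (α / 2) := by positivity
  rw [Real.sqrt_mul hB] at h
  set b := √(8 + 1 / (α / 2)) with hb
  have hb0 : 0 ≤ b := Real.sqrt_nonneg _
  set m := M ^ (α * β / 2) with hm
  have hm1 : 1 ≤ m := Real.one_le_rpow hM (by positivity)
  have hd0 : 0 ≤ d := by
    rw [hd]; exact intervalIntegral.integral_nonneg hR.le fun r hr => mul_nonneg (sq_nonneg _) hr.1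
  have e1 : (M ^ (-β)) ^ (-(α / 2)) = m := by
    rw [← Real.rpow_mul hM0.le, hm]; congr 1; ring
  have e2 : (M ^ (-β)) ^ (1 / 2 - α / 2) * √(M ^ β) = m := by
    rw [← Real.rpow_mul hM0.le, hm, Real.sqrt_eq_rpow, ← Real.rpow_mul hM0.le,
      ← Real.rpow_add hM0]; congr 1; ring
  have sA : √A ≤ √C4 * √(M ^ β) * √Y := by
    rw [← Real.sqrt_mul hC4, ← Real.sqrt_mul (by positivity)]
    exact Real.sqrt_le_sqrt hAY
  have sd : √d ≤ √(2 / μ) * √Y := by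
    rw [← Real.sqrt_mul (by positivity)]; exact Real.sqrt_le_sqrt hdY
  have sA2 : √A ≤ 4 * R * √N := by
    rw [hA, hN]; exact poinc hR hGc hGc' hG hrs h0
  have t1 : b * √N * (M ^ (-β)) ^ (-(α / 2)) * d ≤ b * √(2 / μ) * (m * (√N * √d * √Y)) := by
    rw [e1]
    calc b * √N * m * d = b * √N * m * √d * √d := by rw [mul_assoc _ √d √d, Real.mul_self_sqrt hd0]
      _ ≤ b * √N * m * √d * (√(2 / μ) * √Y) := by gcongr
      _ = _ := by ring
  have t2 : 1 / (2 * μ) * (b * √N) * (M ^ (-β)) ^ (1 / 2 - α / 2) * (√6 * √A * √d)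
      ≤ 1 / (2 * μ) * b * √6 * √C4 * (m * (√N * √d * √Y)) := by
    calc _ ≤ 1 / (2 * μ) * (b * √N) * (M ^ (-β)) ^ (1 / 2 - α / 2) * (√6 * (√C4 * √(M ^ β) * √Y) * √d) := by
          gcongr
      _ = 1 / (2 * μ) * b * √6 * √C4 * (((M ^ (-β)) ^ (1 / 2 - α / 2) * √(M ^ β)) * (√N * √d * √Y)) := by ring
      _ = _ := by rw [e2]
  have t3 : 1 / (2 * μ) * L * (√A * √d) ≤ 1 / (2 * μ) * Cc * (4 * R) * (m * (√N * √d * √Y)) := by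
    calc _ ≤ 1 / (2 * μ) * (Cc * √Y) * (4 * R * √N * √d) := by gcongr
      _ = 1 / (2 * μ) * Cc * (4 * R) * (1 * (√N * √d * √Y)) := by ring
      _ ≤ _ := by gcongr
  linarith

end
end

section
open MeasureTheory Set Filter
open scoped Topology ContDiff
noncomputable section

/-- lower bound for the modified energy -/
lemma Y_lower {μ β γ R M S Y : ℝ} (hμ : 0 < μ) (hβ : 1 < β) (hγ : 1 < γ) (hR : 0 < R)
    {p D : ℝ → ℝ} (hpc : Continuous p) (hDc : Continuous D) (hp : ∀ r ∈ Icc 0 R, 0 < p r)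
    (hpM : ∀ r ∈ Icc 0 R, p r ≤ M)
    (hS : S = ∫ r in (0:ℝ)..R, (2 * μ + p r ^ β) * D r ^ 2 * r)
    (hY : Y = 1 / 2 * S - (∫ r in (0:ℝ)..R, p r ^ γ * D r * r) + (R ^ 2 / (4 * μ) + 1) * M ^ (2 * γ)) :
    S / 4 + M ^ (2 * γ) ≤ Y := by
  have := Y_bound (γ := γ) hμ hβ hγ hR hpc hDc hp hpM
  rw [← hS] at this
  have := (abs_le.1 this).2
  nlinarith

set_option maxHeartbeats 1000000 in
lemma static_main {μ β γ R α E : ℝ} (hμ : 0 < μ) (hβ : 1 < β) (hγ : 1 < γ) (hR : 0 < R)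
    (hα0 : 0 < α) (hα1 : α < 1) (hE : 0 < E) :
    ∃ C > 0, ∀ M : ℝ, 1 ≤ M → ∀ p w w' F F' : ℝ → ℝ, ∀ a D : ℝ → ℝ, ∀ S Y : ℝ,
      Continuous p → Continuous w → Continuous w' → Continuous a →
      (∀ r, HasDerivAt w (w' r) r) → w R = 0 → (∀ r, D r = 2 * w r + r * w' r) →
      (∀ r ∈ Icc 0 R, 0 < p r) → (∀ r ∈ Icc 0 R, p r ≤ M) →
      (∫ r in (0:ℝ)..R, p r ^ γ * r ≤ E) →
      (∀ r, F r = (2 * μ + p r ^ β) * D r - p r ^ γ) →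
      (∀ r, F' r = p r * (r * a r)) →
      (∀ r ∈ Icc 0 R, HasDerivAt F (F' r) r) →
      (S = ∫ r in (0:ℝ)..R, (2 * μ + p r ^ β) * D r ^ 2 * r) →
      (Y = 1 / 2 * S - (∫ r in (0:ℝ)..R, p r ^ γ * D r * r) + (R ^ 2 / (4 * μ) + 1) * M ^ (2 * γ)) →
      -(∫ r in (0:ℝ)..R, F' r * (r * w r) ^ 2) +
        (∫ r in (0:ℝ)..R, (1 / 2 * (2 * μ + p r ^ β - β * p r ^ β) * D r ^ 3
          + (γ - 1) * (p r ^ γ * D r ^ 2) - F r * D r ^ 2) * r)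
        ≤ (∫ r in (0:ℝ)..R, p r * (r * a r) ^ 2 * r) + C * M ^ (1 + α * β) * S * Y := by
  set C0 : ℝ := (2 * μ + (16 * E / (3 * R ^ 2)) ^ (β / γ)) * (16 / (3 * R ^ 2)) with hC0
  have hC00 : 0 ≤ C0 := by positivity
  set CX : ℝ := 8 + R ^ 2 / (2 * μ) with hCX
  have hCX0 : 0 ≤ CX := by positivity
  set Cc : ℝ := √(C0 * CX) with hCc
  have hCc0 : 0 ≤ Cc := Real.sqrt_nonneg _
  set C4 : ℝ := 2 * (2 * μ + 1) * CX + R ^ 2 * (C0 * CX) with hC4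
  have hC40 : 0 ≤ C4 := by positivity
  set C5 : ℝ := √(8 + 1 / (α / 2)) * √(2 / μ) + 1 / (2 * μ) * √(8 + 1 / (α / 2)) * √6 * √C4
        + 1 / (2 * μ) * (Cc + 1) * (4 * R) with hC5
  have hC50 : 0 ≤ C5 := by positivity
  set C6 : ℝ := √(2 / μ) + (1 + β) * C5 with hC6
  have hC60 : 0 ≤ C6 := by positivity
  set C7 : ℝ := (1 + β) * Cc + (β + γ) with hC7
  have hC70 : 0 < C7 := by positivity
  refine ⟨(C6 ^ 2 / 4 + C7) / (2 * μ), by positivity, ?_⟩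
  clear_value C7 C6 C5 C4 Cc CX C0
  intro M hM p w w' F F' a D S Y hpc hwc hwc' hac hw hwR hD hp hpM hPE hF hF' hFd hS hY
  have hM0 : 0 < M := by linarith
  have hcβ : Continuous fun r => p r ^ β := hpc.rpow_const (fun _ => Or.inr (by linarith))
  have hcγ : Continuous fun r => p r ^ γ := hpc.rpow_const (fun _ => Or.inr (by linarith))
  have hDc : Continuous D := by rw [funext hD]; fun_prop
  have hFc : Continuous F := by rw [funext hF]; fun_prop
  have hF'c : Continuous F' := by rw [funext hF']; fun_prop
  have hQ : ∀ r ∈ Icc 0 R, 0 < 2 * μ + p r ^ β := fun r hr => by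
    have := hp r hr
    positivity
  have hYl := Y_lower hμ hβ hγ hR hpc hDc hp hpM hS hY
  have hS0 : 0 ≤ S := by
    rw [hS]
    refine intervalIntegral.integral_nonneg hR.le fun r hr => ?_
    have := hQ r hr
    have := hr.1
    positivity
  have hMγ : 1 ≤ M ^ γ := Real.one_le_rpow hM (by linarith)
  have hM2 : M ^ (2 * γ) = (M ^ γ) ^ 2 := by
    rw [← Real.rpow_natCast, ← Real.rpow_mul hM0.le]; congr 1; push_cast; ring
  rw [hM2] at hYl
  have hMγ2 : 1 ≤ (M ^ γ) ^ 2 := one_le_pow₀ hMγ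
  have hY1 : 1 ≤ Y := by linarith
  have hY0 : 0 < Y := by linarith
  have hSY : S ≤ 4 * Y := by linarith
  have hMY : M ^ γ ≤ √Y := Real.le_sqrt_of_sq_le (by linarith)
  have hsY : √Y ≤ Y := by
    rw [Real.sqrt_le_iff]; exact ⟨hY0.le, le_self_pow₀ hY1 two_ne_zero⟩
  set X := ∫ r in (0:ℝ)..R, F r ^ 2 / (2 * μ + p r ^ β) * r with hX
  clear_value X
  have hXY : X ≤ CX * Y := by
    have := X_bound hμ hβ hγ hR hpc hDc hp hpM hF
    rw [← hS, ← hX, hM2] at this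
    have h3 : R ^ 2 / (2 * μ) * (M ^ γ) ^ 2 ≤ R ^ 2 / (2 * μ) * Y := by
      gcongr; linarith
    rw [hCX]; linarith
  obtain ⟨rs, hrs, hc⟩ := rstar hμ hβ hγ hR hE hpc hFc hp hPE hX
  rw [← hC0] at hc
  have hc2 : F rs ^ 2 ≤ C0 * CX * Y := by
    rw [mul_assoc]
    exact hc.trans (mul_le_mul_of_nonneg_left hXY hC00)
  have hcY : |F rs| ≤ Cc * √Y := by
    rw [hCc, ← Real.sqrt_mul (by positivity)]; exact Real.abs_le_sqrt hc2
  obtain ⟨c, hcdef⟩ : ∃ c, c = F rs := ⟨_, rfl⟩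
  rw [← hcdef] at hc hc2 hcY
  set d := ∫ r in (0:ℝ)..R, D r ^ 2 * r with hd
  have hd0 : 0 ≤ d := intervalIntegral.integral_nonneg hR.le fun r hr =>
    mul_nonneg (sq_nonneg _) hr.1
  clear_value d
  have hdS : d ≤ S / (2 * μ) := by
    rw [le_div_iff₀ (by positivity), hS, hd, ← intervalIntegral.integral_mul_const]
    refine intervalIntegral.integral_mono_on hR.le ?_ ?_ ?_
    · exact Continuous.intervalIntegrable (by fun_prop) _ _
    · exact Continuous.intervalIntegrable (by fun_prop) _ _
    · intro r hr
      have h1 : 0 < p r ^ β := Real.rpow_pos_of_pos (hp r hr) _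
      have h2 : 0 ≤ D r ^ 2 * r := mul_nonneg (sq_nonneg _) hr.1
      have h3 := mul_nonneg h1.le h2
      linarith
  have hdY : d ≤ 2 / μ * Y := by
    refine hdS.trans ?_
    rw [div_le_iff₀ (by positivity)]
    have : 2 / μ * Y * (2 * μ) = 4 * Y := by field_simp; ring
    linarith
  set N := ∫ r in (0:ℝ)..R, F' r ^ 2 * r with hN
  set B := ∫ r in (0:ℝ)..R, p r * (r * a r) ^ 2 * r with hB
  clear_value N B
  have hB0 : 0 ≤ B := by
    rw [hB]
    refine intervalIntegral.integral_nonneg hR.le fun r hr => ?_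
    have := hp r hr
    have := hr.1
    positivity
  have hNB : N ≤ M * B := by
    rw [hN, hB, ← intervalIntegral.integral_const_mul]
    refine intervalIntegral.integral_mono_on hR.le ?_ ?_ ?_
    · exact Continuous.intervalIntegrable (by fun_prop) _ _
    · exact Continuous.intervalIntegrable (by fun_prop) _ _
    · intro r hr
      have h1 := hp r hr
      have h2 := hr.1
      have h3 := hpM r hr
      rw [hF']
      calc _ = p r * (p r * (r * a r) ^ 2 * r) := by ring
        _ ≤ _ := by gcongr
  have hFF : ∫ r in (0:ℝ)..R, F r ^ 2 * r ≤ (2 * μ + 1) * M ^ β * (CX * Y) := by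
    refine le_trans ?_ (mul_le_mul_of_nonneg_left hXY (by positivity))
    rw [hX, ← intervalIntegral.integral_const_mul]
    refine intervalIntegral.integral_mono_on hR.le ?_ ?_ ?_
    · exact Continuous.intervalIntegrable (by fun_prop) _ _
    · refine ContinuousOn.intervalIntegrable ?_
      rw [uIcc_of_le hR.le]
      exact continuousOn_const.mul ((ContinuousOn.div (by fun_prop)
        (Continuous.continuousOn (by fun_prop)) (fun r hr => (hQ r hr).ne')).mul continuousOn_id)
    · intro r hr
      have h1 := hQ r hr
      have h2 := hr.1
      have h3 : 2 * μ + p r ^ β ≤ (2 * μ + 1) * M ^ β := by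
        have : p r ^ β ≤ M ^ β := Real.rpow_le_rpow (hp r hr).le (hpM r hr) (by linarith)
        have h4 : 1 ≤ M ^ β := Real.one_le_rpow hM (by linarith)
        have h5 := mul_le_mul_of_nonneg_left h4 hμ.le
        linarith
      calc F r ^ 2 * r = (2 * μ + p r ^ β) * (F r ^ 2 / (2 * μ + p r ^ β) * r) := by
            field_simp
        _ ≤ _ := by gcongr
  set G : ℝ → ℝ := fun r => F r - c with hG
  have hGc : Continuous G := by fun_prop
  have hA : ∫ r in (0:ℝ)..R, G r ^ 2 * r ≤ C4 * M ^ β * Y := by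
    have h1 : ∫ r in (0:ℝ)..R, G r ^ 2 * r ≤ ∫ r in (0:ℝ)..R, (2 * (F r ^ 2 * r) + 2 * c ^ 2 * r) := by
      refine intervalIntegral.integral_mono_on hR.le ?_ ?_ ?_
      · exact Continuous.intervalIntegrable (by fun_prop) _ _
      · exact Continuous.intervalIntegrable (by fun_prop) _ _
      · intro r hr
        simp only [hG]
        have := mul_nonneg (sq_nonneg (F r + c)) hr.1
        linarith
    rw [intervalIntegral.integral_add, intervalIntegral.integral_const_mul,
      intervalIntegral.integral_const_mul, integral_id] at h1
    rotate_left
    · exact Continuous.intervalIntegrable (by fun_prop) _ _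
    · exact Continuous.intervalIntegrable (by fun_prop) _ _
    have h2 : 1 ≤ M ^ β := Real.one_le_rpow hM (by linarith)
    have h3 : 2 * c ^ 2 * ((R ^ 2 - 0 ^ 2) / 2) ≤ R ^ 2 * (C0 * CX) * M ^ β * Y := by
      calc _ = R ^ 2 * c ^ 2 * 1 := by ring
        _ ≤ R ^ 2 * (C0 * CX * Y) * M ^ β := by gcongr
        _ = _ := by ring
    rw [hC4]
    linarith
  have hLY : |c| + M ^ γ ≤ (Cc + 1) * √Y := by linarith
  have hDG : ∀ r ∈ Icc 0 R, |D r| ≤ 1 / (2 * μ) * (|G r| + (|c| + M ^ γ)) := by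
    intro r hr
    have h1 : 0 < p r ^ β := Real.rpow_pos_of_pos (hp r hr) _
    have h2 : p r ^ γ ≤ M ^ γ := Real.rpow_le_rpow (hp r hr).le (hpM r hr) (by linarith)
    have h3 : 0 < p r ^ γ := Real.rpow_pos_of_pos (hp r hr) _
    have e : (2 * μ + p r ^ β) * D r = G r + c + p r ^ γ := by simp only [hG, hF]; ring
    have h4 : (2 * μ + p r ^ β) * |D r| ≤ |G r| + |c| + p r ^ γ := by
      rw [← abs_of_pos (hQ r hr), ← abs_mul, e]
      refine (abs_add_le _ _).trans ?_
      rw [abs_of_pos h3]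
      gcongr
      exact abs_add_le _ _
    rw [one_div, inv_mul_eq_div, le_div_iff₀ (by positivity)]
    have h5 := mul_nonneg h1.le (abs_nonneg (D r))
    linarith
  have hI := interp_norm (β := β) hμ hβ hR hα0 hα1 hM hY1 (by positivity : 0 ≤ Cc + 1) hC40 hGc hF'c hDc
    (fun r hr => (hFd r hr).sub_const c) hrs (by simp only [hG, hcdef, sub_self]) rfl hN hd
    (by positivity) hDG hLY hA hdY
  rw [← hC5] at hI
  set m := M ^ (α * β / 2) with hm
  have hm1 : 1 ≤ m := Real.one_le_rpow hM (by positivity)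
  clear_value m
  have sd : √d ≤ √(2 / μ) * √Y := by
    rw [← Real.sqrt_mul (by positivity)]; exact Real.sqrt_le_sqrt hdY
  -- first term
  have hT1 : -(∫ r in (0:ℝ)..R, F' r * (r * w r) ^ 2) ≤ √(2 / μ) * (m * (√N * √d * √Y)) := by
    have h1 := flux_wr hR hwc hwc' hw hwR hF'c
    have e : ∫ r in (0:ℝ)..R, (2 * w r + r * w' r) ^ 2 * r = d := by
      rw [hd]; exact intervalIntegral.integral_congr fun r _ => by rw [hD]
    rw [e, ← hN] at h1
    refine (neg_le_abs _).trans (h1.trans ?_)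
    calc √N * d = √N * (√d * √d) := by rw [Real.mul_self_sqrt hd0]
      _ ≤ √N * (√d * (√(2 / μ) * √Y)) := by gcongr
      _ = √(2 / μ) * (1 * (√N * √d * √Y)) := by ring
      _ ≤ _ := by gcongr
  -- second term
  have hT2 : (∫ r in (0:ℝ)..R, (1 / 2 * (2 * μ + p r ^ β - β * p r ^ β) * D r ^ 3
          + (γ - 1) * (p r ^ γ * D r ^ 2) - F r * D r ^ 2) * r)
      ≤ (1 + β) * (C5 * (m * (√N * √d * √Y))) + C7 * Y * d := by
    have h1 : (∫ r in (0:ℝ)..R, (1 / 2 * (2 * μ + p r ^ β - β * p r ^ β) * D r ^ 3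
          + (γ - 1) * (p r ^ γ * D r ^ 2) - F r * D r ^ 2) * r)
        ≤ ∫ r in (0:ℝ)..R, ((1 + β) * (|G r| * D r ^ 2 * r) + C7 * Y * (D r ^ 2 * r)) := by
      refine intervalIntegral.integral_mono_on hR.le ?_ ?_ ?_
      · exact Continuous.intervalIntegrable (by fun_prop) _ _
      · exact Continuous.intervalIntegrable (by fun_prop) _ _
      · intro r hr
        have hr0 := hr.1
        have h1 : 0 < p r ^ β := Real.rpow_pos_of_pos (hp r hr) _
        have h3 : 0 < p r ^ γ := Real.rpow_pos_of_pos (hp r hr) _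
        have h2 : p r ^ γ ≤ M ^ γ := Real.rpow_le_rpow (hp r hr).le (hpM r hr) (by linarith)
        have h4 := pt_bracket (γ := γ) hμ hβ h1.le h3.le (hF r)
        have h5 : |F r| ≤ |G r| + |c| := by
          have : F r = G r + c := by simp only [hG]; ring
          rw [this]; exact abs_add_le _ _
        have h6 : (1 + β) * |F r| + (β + γ) * p r ^ γ ≤ (1 + β) * |G r| + C7 * Y := by
          calc _ ≤ (1 + β) * (|G r| + Cc * √Y) + (β + γ) * √Y := by
                gcongr
                · linarith
                · linarith
            _ = (1 + β) * |G r| + C7 * √Y := by rw [hC7]; ring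
            _ ≤ _ := by gcongr
        calc _ ≤ D r ^ 2 * ((1 + β) * |F r| + (β + γ) * p r ^ γ) * r := by gcongr
          _ ≤ D r ^ 2 * ((1 + β) * |G r| + C7 * Y) * r := by gcongr
          _ = _ := by ring
    rw [intervalIntegral.integral_add, intervalIntegral.integral_const_mul,
      intervalIntegral.integral_const_mul] at h1
    rotate_left
    · exact Continuous.intervalIntegrable (by fun_prop) _ _
    · exact Continuous.intervalIntegrable (by fun_prop) _ _
    rw [← hd] at h1
    refine h1.trans ?_
    gcongr
  -- Young
  have sN : √N ≤ √M * √B := by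
    rw [← Real.sqrt_mul hM0.le]; exact Real.sqrt_le_sqrt hNB
  have hMm : M ^ (1 + α * β) = M * m ^ 2 := by
    rw [hm, ← Real.rpow_natCast, ← Real.rpow_mul hM0.le, Real.rpow_add hM0, Real.rpow_one]
    congr 2; push_cast; ring
  have hM1 : 1 ≤ M ^ (1 + α * β) := Real.one_le_rpow hM (by positivity)
  have hY3 : C6 * (m * (√N * √d * √Y)) ≤ B + C6 ^ 2 / 4 * (M ^ (1 + α * β) * (d * Y)) := by
    have h1 : C6 * (m * (√N * √d * √Y)) ≤ C6 * (m * (√M * √B * √d * √Y)) := by gcongr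
    have h2 : (C6 * (m * (√M * √d * √Y))) ^ 2 = C6 ^ 2 * (M ^ (1 + α * β) * (d * Y)) := by
      calc _ = C6 ^ 2 * (m ^ 2 * (√M ^ 2 * √d ^ 2 * √Y ^ 2)) := by ring
        _ = _ := by
          rw [Real.sq_sqrt hM0.le, Real.sq_sqrt hd0, Real.sq_sqrt hY0.le, hMm]; ring
    have h3 := Real.sq_sqrt hB0
    have h4 := sq_nonneg (√B - C6 * (m * (√M * √d * √Y)) / 2)
    have h5 : (√B - C6 * (m * (√M * √d * √Y)) / 2) ^ 2
        = √B ^ 2 - C6 * (m * (√M * √B * √d * √Y)) + (C6 * (m * (√M * √d * √Y))) ^ 2 / 4 := by ring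
    rw [h5, h2, h3] at h4
    linarith
  have hY4 : C7 * Y * d ≤ C7 * (M ^ (1 + α * β) * (d * Y)) := by
    calc _ = C7 * (1 * (d * Y)) := by ring
      _ ≤ _ := by gcongr
  have hfin : (C6 ^ 2 / 4 + C7) * (M ^ (1 + α * β) * (d * Y))
      ≤ (C6 ^ 2 / 4 + C7) / (2 * μ) * M ^ (1 + α * β) * S * Y := by
    calc _ ≤ (C6 ^ 2 / 4 + C7) * (M ^ (1 + α * β) * (S / (2 * μ) * Y)) := by gcongr
      _ = _ := by ring
  have : √(2 / μ) * (m * (√N * √d * √Y)) + (1 + β) * (C5 * (m * (√N * √d * √Y)))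
      = C6 * (m * (√N * √d * √Y)) := by rw [hC6]; ring
  linarith

end
end

section
open MeasureTheory Set Filter
open scoped Topology ContDiff
noncomputable section

/-- divergence of the velocity `u = r w` -/
def Df (w : ℝ → ℝ → ℝ) (r t : ℝ) : ℝ := 2 * w r t + r * pr w r t
/-- material derivative of the velocity `u = r w`, divided by `r` -/
def Af (w : ℝ → ℝ → ℝ) (r t : ℝ) : ℝ := pt w r t + w r t * (w r t + r * pr w r t)

lemma Sm.Df {w} (h : Sm w) : Sm (Df w) :=
  (contDiff_const.mul h).add (contDiff_fst.mul h.pr)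

lemma Sm.Af {w} (h : Sm w) : Sm (Af w) :=
  ContDiff.add h.pt (h.mul (h.add (contDiff_fst.mul h.pr)))

lemma pr_Df {w} (h : Sm w) (r t : ℝ) : pr (Df w) r t = 3 * pr w r t + r * pr (pr w) r t := by
  have : HasDerivAt (fun s => Df w s t) (3 * pr w r t + r * pr (pr w) r t) r := by
    refine (((h.hr r t).const_mul 2).add ((hasDerivAt_id r).mul (h.pr.hr r t))).congr_deriv ?_
    simp; ring
  exact this.deriv

lemma pt_Df {w} (h : Sm w) (r t : ℝ) : pt (Df w) r t = 2 * pt w r t + r * pt (pr w) r t := by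
  have : HasDerivAt (fun s => Df w r s) (2 * pt w r t + r * pt (pr w) r t) t :=
    ((h.ht r t).const_mul 2).add ((h.pr.ht r t).const_mul r)
  exact this.deriv

lemma pr_Af {w} (h : Sm w) (r t : ℝ) : pr (Af w) r t = pt (pr w) r t
    + pr w r t * (w r t + r * pr w r t) + w r t * (2 * pr w r t + r * pr (pr w) r t) := by
  have : HasDerivAt (fun s => Af w s t) (pt (pr w) r t
    + pr w r t * (w r t + r * pr w r t) + w r t * (2 * pr w r t + r * pr (pr w) r t)) r := by
    refine ((h.pt.hr r t).add ((h.hr r t).mul ((h.hr r t).add ((hasDerivAt_id r).mul (h.pr.hr r t))))).congr_deriv ?_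
    rw [h.comm]
    simp; ring
  exact this.deriv

lemma Ddot {w} (h : Sm w) (r t : ℝ) : pt (Df w) r t + r * w r t * pr (Df w) r t
    = 2 * Af w r t + r * pr (Af w) r t - ((w r t + r * pr w r t) ^ 2 + w r t ^ 2) := by
  rw [pr_Df h, pt_Df h, pr_Af h, Af]; ring

/-- effective flux -/
def Ff (μ β γ : ℝ) (ρ w : ℝ → ℝ → ℝ) (r t : ℝ) : ℝ :=
  (2 * μ + ρ r t ^ β) * Df w r t - ρ r t ^ γ

/-- solution written in terms of `w = u / r` -/
structure WSol (μ β γ R T : ℝ) (ρ w : ℝ → ℝ → ℝ) : Prop where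
  hμ : 0 < μ
  hβ : 1 < β
  hγ : 1 < γ
  hR : 0 < R
  hT : 0 < T
  sρ : Sm ρ
  sw : Sm w
  pos : ∀ r ∈ Icc 0 R, ∀ t ∈ Icc 0 T, 0 < ρ r t
  bc : ∀ t ∈ Icc 0 T, w R t = 0
  mass : ∀ r ∈ Icc 0 R, ∀ t ∈ Ioo 0 T,
    pt ρ r t + r * w r t * pr ρ r t = - (ρ r t * Df w r t)
  mom : ∀ r ∈ Icc 0 R, ∀ t ∈ Ioo 0 T,
    HasDerivAt (fun s => Ff μ β γ ρ w s t) (ρ r t * (r * Af w r t)) r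

lemma Sm.slr {f} (h : Sm f) (t : ℝ) : Continuous (fun r => f r t) :=
  h.cont.comp (f := fun r => (r, t)) (by fun_prop)

lemma toW {μ β γ R T : ℝ} {ρ u : ℝ → ℝ → ℝ} (h : RadialSolution μ β γ R T ρ u) :
    WSol μ β γ R T ρ (hq u) ∧ ∀ t ∈ Icc 0 T, ∀ r, u r t = r * hq u r t := by
  obtain ⟨hμ, hβ, hγ, hR, hT, sρ, su, pos, mass, mom, bc0, bcR⟩ := h
  have sρ : Sm ρ := contDiff_infty.2 sρ
  have su : Sm u := contDiff_infty.2 su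
  have sw : Sm (hq u) := su.hq
  have hu : ∀ t ∈ Icc 0 T, ∀ r, u r t = r * hq u r t := by
    intro t ht r
    rw [hq_mul su, bc0 t ht, sub_zero]
  set w := hq u with hw
  have hur : ∀ t ∈ Icc 0 T, ∀ r, HasDerivAt (fun s => u s t) (w r t + r * pr w r t) r := by
    intro t ht r
    have e : (fun s => u s t) = fun s => s * w s t := funext fun s => hu t ht s
    rw [e]
    refine ((hasDerivAt_id r).mul (sw.hr r t)).congr_deriv ?_
    simp
  have hut : ∀ t ∈ Ioo 0 T, ∀ r, HasDerivAt (fun τ => u r τ) (r * pt w r t) t := by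
    intro t ht r
    refine ((sw.ht r t).const_mul r).congr_of_eventuallyEq ?_
    filter_upwards [Ioo_mem_nhds ht.1 ht.2] with τ hτ
    exact hu τ ⟨hτ.1.le, hτ.2.le⟩ r
  have hrd : ∀ t ∈ Icc 0 T, ∀ r, r ≠ 0 → rdiv u r t = Df w r t := by
    intro t ht r hr
    rw [rdiv, (hur t ht r).deriv, Df, hu t ht r]
    field_simp; ring
  have hmass0 : ∀ r ∈ Ioo 0 R, ∀ t ∈ Ioo 0 T,
      pt ρ r t + r * w r t * pr ρ r t = - (ρ r t * Df w r t) := by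
    intro r hr t ht
    have ht' : t ∈ Icc 0 T := ⟨ht.1.le, ht.2.le⟩
    have h1 := mass r hr t ht'
    have h2 : deriv (fun s => ρ s t * u s t) r = pr ρ r t * u r t + ρ r t * (w r t + r * pr w r t) :=
      ((sρ.hr r t).mul (hur t ht' r)).deriv
    rw [h2, hu t ht' r] at h1
    have h3 : ρ r t * (r * w r t) / r = ρ r t * w r t := by
      have := hr.1.ne'
      field_simp
    rw [h3] at h1
    rw [pt, Df]
    linarith
  have hcl : Icc 0 R ⊆ closure (Ioo 0 R) := by rw [closure_Ioo hR.ne]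
  have hmass : ∀ r ∈ Icc 0 R, ∀ t ∈ Ioo 0 T,
      pt ρ r t + r * w r t * pr ρ r t = - (ρ r t * Df w r t) := by
    intro r hr t ht
    have := EqOn.of_subset_closure (s := Ioo 0 R) (t := Icc 0 R)
      (f := fun r => pt ρ r t + r * w r t * pr ρ r t) (g := fun r => - (ρ r t * Df w r t))
      (fun r hr => hmass0 r hr t ht) ?_ ?_ Ioo_subset_Icc_self hcl
    · exact this hr
    · have h1 := sρ.pt.slr t
      have h2 := sρ.pr.slr t
      have h3 := sw.slr t
      fun_prop
    · have h1 := sρ.slr t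
      have h2 := sw.Df.slr t
      fun_prop
  refine ⟨⟨hμ, hβ, hγ, hR, hT, sρ, sw, pos, ?_, hmass, ?_⟩, hu⟩
  · intro t ht
    have h1 := hu t ht R
    rw [bcR t ht] at h1
    rcases mul_eq_zero.1 h1.symm with h | h
    · exact absurd h hR.ne'
    · exact h
  · intro r hr t ht
    have ht' : t ∈ Icc 0 T := ⟨ht.1.le, ht.2.le⟩
    have hd : ∀ r ∈ Icc 0 R, HasDerivAt (fun s => Ff μ β γ ρ w s t)
        (pr ρ r t * β * ρ r t ^ (β - 1) * Df w r t + (2 * μ + ρ r t ^ β) * pr (Df w) r t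
          - pr ρ r t * γ * ρ r t ^ (γ - 1)) r := by
      intro r hr
      have hp := pos r hr t ht'
      exact ((((sρ.hr r t).rpow_const (Or.inl hp.ne')).const_add (2 * μ)).mul (sw.Df.hr r t)).sub
        ((sρ.hr r t).rpow_const (Or.inl hp.ne'))
    have he : ∀ r ∈ Ioo 0 R, pr ρ r t * β * ρ r t ^ (β - 1) * Df w r t + (2 * μ + ρ r t ^ β) * pr (Df w) r t
          - pr ρ r t * γ * ρ r t ^ (γ - 1) = ρ r t * (r * Af w r t) := by
      intro r hr
      have hr' : r ∈ Icc 0 R := ⟨hr.1.le, hr.2.le⟩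
      have hp := pos r hr' t ht'
      have m := mom r hr t ht'
      have e1 : deriv (fun τ => ρ r τ * u r τ) t = pt ρ r t * u r t + ρ r t * (r * pt w r t) :=
        ((sρ.ht r t).mul (hut t ht r)).deriv
      have e2 : deriv (fun s => ρ s t * u s t ^ 2) r
          = pr ρ r t * u r t ^ 2 + ρ r t * (2 * u r t * (w r t + r * pr w r t)) := by
        refine HasDerivAt.deriv (((sρ.hr r t).mul ((hur t ht' r).pow 2)).congr_deriv ?_)
        simp
      have e3 : deriv (fun s => ρ s t ^ γ) r = pr ρ r t * γ * ρ r t ^ (γ - 1) :=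
        ((sρ.hr r t).rpow_const (Or.inl hp.ne')).deriv
      have e4 : deriv (fun s => (2 * μ + ρ s t ^ β) * rdiv u s t) r =
          pr ρ r t * β * ρ r t ^ (β - 1) * Df w r t + (2 * μ + ρ r t ^ β) * pr (Df w) r t := by
        refine HasDerivAt.deriv ?_
        refine ((((sρ.hr r t).rpow_const (Or.inl hp.ne')).const_add (2 * μ)).mul
          (sw.Df.hr r t)).congr_of_eventuallyEq ?_
        filter_upwards [Ioo_mem_nhds hr.1 hr.2] with s hs
        rw [hrd t ht' s hs.1.ne']
        simp
      have ms := hmass0 r hr t ht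
      rw [e1, e2, e3, e4, hu t ht' r] at m
      have h3 : ρ r t * (r * w r t) ^ 2 / r = ρ r t * r * w r t ^ 2 := by
        have := hr.1.ne'
        field_simp
      rw [h3] at m
      rw [Df] at ms
      rw [Af]
      linear_combination (-1) * m + (r * w r t) * ms
    have := EqOn.of_subset_closure (s := Ioo 0 R) (t := Icc 0 R) he ?_ ?_ Ioo_subset_Icc_self hcl
    · exact (hd r hr).congr_deriv (this hr)
    · have h1 := sρ.slr t
      have h2 := sρ.pr.slr t
      have h3 := sw.Df.slr t
      have h4 := sw.Df.pr.slr t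
      have h5 : ∀ θ : ℝ, ContinuousOn (fun r => ρ r t ^ θ) (Icc 0 R) := fun θ =>
        h1.continuousOn.rpow_const fun r hr => Or.inl (pos r hr t ht').ne'
      have h6 := h5 β
      have h7 := h5 (β - 1)
      have h8 := h5 (γ - 1)
      exact ((((h2.continuousOn.mul continuousOn_const).mul h7).mul h3.continuousOn).add
        ((continuousOn_const.add h6).mul h4.continuousOn)).sub
        ((h2.continuousOn.mul continuousOn_const).mul h8)
    · have h1 := sρ.slr t
      have h2 := sw.Af.slr t
      fun_prop

end
end

section
open MeasureTheory Set Filter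
open scoped Topology ContDiff
noncomputable section

lemma ibp {R : ℝ} (hR : 0 < R) {F F' v v' : ℝ → ℝ} (hF : ∀ r ∈ Icc 0 R, HasDerivAt F (F' r) r)
    (hF'c : Continuous F') (hv : ∀ r, HasDerivAt v (v' r) r) (hvc' : Continuous v') (hvR : v R = 0)
    (hFc : Continuous F) (hvc : Continuous v) :
    ∫ r in (0:ℝ)..R, F' r * (r * v r) * r = - ∫ r in (0:ℝ)..R, F r * (2 * v r + r * v' r) * r := by
  have h := intervalIntegral.integral_eq_sub_of_hasDerivAt (a := 0) (b := R)
      (f := fun r => F r * (r ^ 2 * v r))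
      (f' := fun r => F' r * (r * v r) * r + F r * (2 * v r + r * v' r) * r) ?_ ?_
  · rw [intervalIntegral.integral_add, hvR] at h
    · simp only [mul_zero, ne_eq, OfNat.ofNat_ne_zero, not_false_eq_true, zero_pow, zero_mul,
        sub_self] at h
      linarith
    · exact Continuous.intervalIntegrable (by fun_prop) _ _
    · exact Continuous.intervalIntegrable (by fun_prop) _ _
  · intro r hr
    rw [uIcc_of_le hR.le] at hr
    refine ((hF r hr).mul (((hasDerivAt_id r).pow 2).mul (hv r))).congr_deriv ?_
    simp; ring
  · exact Continuous.intervalIntegrable (by fun_prop) _ _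

lemma ibp2 {R : ℝ} (hR : 0 < R) {F F' v v' : ℝ → ℝ} (hF : ∀ r ∈ Icc 0 R, HasDerivAt F (F' r) r)
    (hF'c : Continuous F') (hv : ∀ r, HasDerivAt v (v' r) r) (hvc' : Continuous v') (hvR : v R = 0)
    (hFc : Continuous F) (hvc : Continuous v) :
    ∫ r in (0:ℝ)..R, F r * ((v r + r * v' r) ^ 2 + v r ^ 2) * r
      = (∫ r in (0:ℝ)..R, F r * (2 * v r + r * v' r) ^ 2 * r) + ∫ r in (0:ℝ)..R, F' r * (r * v r) ^ 2 := by
  have h := intervalIntegral.integral_eq_sub_of_hasDerivAt (a := 0) (b := R)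
      (f := fun r => F r * (r * v r) ^ 2)
      (f' := fun r => F' r * (r * v r) ^ 2 + F r * (2 * (r * v r) * (v r + r * v' r))) ?_ ?_
  · rw [intervalIntegral.integral_add, hvR] at h
    · simp only [mul_zero, ne_eq, OfNat.ofNat_ne_zero, not_false_eq_true, zero_pow, zero_mul,
        sub_self] at h
      have e : ∫ r in (0:ℝ)..R, F r * (2 * v r + r * v' r) ^ 2 * r
          = (∫ r in (0:ℝ)..R, F r * ((v r + r * v' r) ^ 2 + v r ^ 2) * r)
            + ∫ r in (0:ℝ)..R, F r * (2 * (r * v r) * (v r + r * v' r)) := by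
        rw [← intervalIntegral.integral_add]
        · exact intervalIntegral.integral_congr fun r _ => by ring
        · exact Continuous.intervalIntegrable (by fun_prop) _ _
        · exact Continuous.intervalIntegrable (by fun_prop) _ _
      linarith
    · exact Continuous.intervalIntegrable (by fun_prop) _ _
    · exact Continuous.intervalIntegrable (by fun_prop) _ _
  · intro r hr
    rw [uIcc_of_le hR.le] at hr
    refine ((hF r hr).mul (((hasDerivAt_id r).mul (hv r)).pow 2)).congr_deriv ?_
    simp
  · exact Continuous.intervalIntegrable (by fun_prop) _ _

section
variable {μ β γ R T : ℝ} {ρ w : ℝ → ℝ → ℝ}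

lemma WSol.rp (h : WSol μ β γ R T ρ w) (θ : ℝ) :
    ContinuousOn (fun x : ℝ × ℝ => ρ x.1 x.2 ^ θ) (Icc 0 R ×ˢ Icc 0 T) :=
  h.sρ.cont.continuousOn.rpow_const fun x hx => Or.inl (h.pos x.1 hx.1 x.2 hx.2).ne'

lemma Sm.co {f} (h : Sm f) (K : Set (ℝ × ℝ)) : ContinuousOn (fun x : ℝ × ℝ => f x.1 x.2) K :=
  h.cont.continuousOn

/-- energy -/
def En (γ R : ℝ) (ρ w : ℝ → ℝ → ℝ) (t : ℝ) : ℝ :=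
  ∫ r in (0:ℝ)..R, (1 / 2 * ρ r t * (r * w r t) ^ 2 + 1 / (γ - 1) * ρ r t ^ γ) * r

/-- dissipation -/
def Dis (μ β R : ℝ) (ρ w : ℝ → ℝ → ℝ) (t : ℝ) : ℝ :=
  ∫ r in (0:ℝ)..R, (2 * μ + ρ r t ^ β) * Df w r t ^ 2 * r

/-- modified energy -/
def Ph (μ β γ R : ℝ) (ρ w : ℝ → ℝ → ℝ) (t : ℝ) : ℝ :=
  ∫ r in (0:ℝ)..R, (1 / 2 * ((2 * μ + ρ r t ^ β) * Df w r t ^ 2) - ρ r t ^ γ * Df w r t) * r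

lemma WSol.cEn (h : WSol μ β γ R T ρ w) : ContinuousOn (En γ R ρ w) (Icc 0 T) := by
  refine cont_under h.hR (g := fun r t =>
    (1 / 2 * ρ r t * (r * w r t) ^ 2 + 1 / (γ - 1) * ρ r t ^ γ) * r) ?_
  exact (((continuousOn_const.mul (h.sρ.co _)).mul ((continuousOn_fst.mul (h.sw.co _)).pow 2)).add
    (continuousOn_const.mul (h.rp γ))).mul continuousOn_fst

lemma WSol.cPh (h : WSol μ β γ R T ρ w) : ContinuousOn (Ph μ β γ R ρ w) (Icc 0 T) := by
  refine cont_under h.hR (g := fun r t =>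
    (1 / 2 * ((2 * μ + ρ r t ^ β) * Df w r t ^ 2) - ρ r t ^ γ * Df w r t) * r) ?_
  exact ((continuousOn_const.mul ((continuousOn_const.add (h.rp β)).mul ((h.sw.Df.co _).pow 2))).sub
    ((h.rp γ).mul (h.sw.Df.co _))).mul continuousOn_fst

lemma WSol.cF (h : WSol μ β γ R T ρ w) (t : ℝ) : Continuous (fun r => Ff μ β γ ρ w r t) := by
  have h1 := h.sρ.slr t
  have h2 := h.sw.Df.slr t
  have hcβ : Continuous fun r => ρ r t ^ β := h1.rpow_const (fun _ => Or.inr (by linarith [h.hβ]))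
  have hcγ : Continuous fun r => ρ r t ^ γ := h1.rpow_const (fun _ => Or.inr (by linarith [h.hγ]))
  unfold Ff
  fun_prop

lemma WSol.dEn (h : WSol μ β γ R T ρ w) {t : ℝ} (ht : t ∈ Ioo 0 T) :
    HasDerivAt (En γ R ρ w) (-Dis μ β R ρ w t) t := by
  have ht' : t ∈ Icc 0 T := ⟨ht.1.le, ht.2.le⟩
  have hγ1 : γ - 1 ≠ 0 := by linarith [h.hγ]
  have key := reynolds h.hR (T := T) (w := w)
    (g := fun r t => 1 / 2 * ρ r t * (r * w r t) ^ 2 + 1 / (γ - 1) * ρ r t ^ γ)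
    (gt := fun r t => 1 / 2 * pt ρ r t * (r * w r t) ^ 2 + 1 / 2 * ρ r t * (2 * (r * w r t) * (r * pt w r t))
      + 1 / (γ - 1) * (pt ρ r t * γ * ρ r t ^ (γ - 1)))
    (gr := fun r t => 1 / 2 * pr ρ r t * (r * w r t) ^ 2
      + 1 / 2 * ρ r t * (2 * (r * w r t) * (w r t + r * pr w r t))
      + 1 / (γ - 1) * (pr ρ r t * γ * ρ r t ^ (γ - 1)))
    h.sw h.bc ?_ ?_ ?_ ?_ ?_ ht
  · refine key.congr_deriv ?_
    have e1 : ∫ r in (0:ℝ)..R, ((1 / 2 * pt ρ r t * (r * w r t) ^ 2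
          + 1 / 2 * ρ r t * (2 * (r * w r t) * (r * pt w r t))
          + 1 / (γ - 1) * (pt ρ r t * γ * ρ r t ^ (γ - 1)))
        + r * w r t * (1 / 2 * pr ρ r t * (r * w r t) ^ 2
          + 1 / 2 * ρ r t * (2 * (r * w r t) * (w r t + r * pr w r t))
          + 1 / (γ - 1) * (pr ρ r t * γ * ρ r t ^ (γ - 1)))
        + (1 / 2 * ρ r t * (r * w r t) ^ 2 + 1 / (γ - 1) * ρ r t ^ γ) * (2 * w r t + r * pr w r t)) * r
        = ∫ r in (0:ℝ)..R, (ρ r t * (r * Af w r t) * (r * w r t) * r - ρ r t ^ γ * Df w r t * r) := by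
      refine intervalIntegral.integral_congr fun r hr => ?_
      rw [uIcc_of_le h.hR.le] at hr
      have hp := h.pos r hr t ht'
      have ms := h.mass r hr t ht
      have ep : ρ r t ^ γ = ρ r t ^ (γ - 1) * ρ r t := by
        rw [← Real.rpow_add_one hp.ne']; congr 1; ring
      have e5 : γ / (γ - 1) = 1 + 1 / (γ - 1) := by field_simp; ring
      rw [ep, Af]
      have ms' : pt ρ r t = - (ρ r t * Df w r t) - r * w r t * pr ρ r t := by linarith
      rw [ms', Df]
      field_simp
      ring
    have c1 := h.sρ.slr t
    have c2 := h.sw.slr t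
    have c3 := h.sw.Af.slr t
    have c4 := h.sw.Df.slr t
    have c5 := h.cF t
    have c6 := h.sw.pr.slr t
    have hcβ : Continuous fun r => ρ r t ^ β := c1.rpow_const (fun _ => Or.inr (by linarith [h.hβ]))
    have hcγ : Continuous fun r => ρ r t ^ γ := c1.rpow_const (fun _ => Or.inr (by linarith [h.hγ]))
    have e2 := ibp h.hR (fun r hr => h.mom r hr t ht) (by fun_prop) (fun r => h.sw.hr r t) c6
      (h.bc t ht') c5 c2
    rw [e1, intervalIntegral.integral_sub, e2, ← intervalIntegral.integral_neg,
      ← intervalIntegral.integral_sub, Dis, ← intervalIntegral.integral_neg]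
    · refine intervalIntegral.integral_congr fun r _ => ?_
      simp only [Ff, Df]; ring
    · exact Continuous.intervalIntegrable (by fun_prop) _ _
    · exact Continuous.intervalIntegrable (by fun_prop) _ _
    · exact Continuous.intervalIntegrable (by fun_prop) _ _
    · exact Continuous.intervalIntegrable (by fun_prop) _ _
  · exact ((continuousOn_const.mul (h.sρ.co _)).mul ((continuousOn_fst.mul (h.sw.co _)).pow 2)).add
      (continuousOn_const.mul (h.rp γ))
  · exact (((continuousOn_const.mul (h.sρ.pt.co _)).mul ((continuousOn_fst.mul (h.sw.co _)).pow 2)).add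
      ((continuousOn_const.mul (h.sρ.co _)).mul ((continuousOn_const.mul
        (continuousOn_fst.mul (h.sw.co _))).mul (continuousOn_fst.mul (h.sw.pt.co _))))).add
      (continuousOn_const.mul (((h.sρ.pt.co _).mul continuousOn_const).mul (h.rp (γ - 1))))
  · exact (((continuousOn_const.mul (h.sρ.pr.co _)).mul ((continuousOn_fst.mul (h.sw.co _)).pow 2)).add
      ((continuousOn_const.mul (h.sρ.co _)).mul ((continuousOn_const.mul
        (continuousOn_fst.mul (h.sw.co _))).mul ((h.sw.co _).add (continuousOn_fst.mul (h.sw.pr.co _)))))).add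
      (continuousOn_const.mul (((h.sρ.pr.co _).mul continuousOn_const).mul (h.rp (γ - 1))))
  · intro r hr t ht
    have hp := h.pos r hr t ⟨ht.1.le, ht.2.le⟩
    refine ((((h.sρ.ht r t).const_mul (1 / 2)).mul (((h.sw.ht r t).const_mul r).pow 2)).add
      (((h.sρ.ht r t).rpow_const (Or.inl hp.ne')).const_mul (1 / (γ - 1)))).congr_deriv ?_
    simp
  · intro r hr t ht
    have hp := h.pos r hr t ⟨ht.1.le, ht.2.le⟩
    refine ((((h.sρ.hr r t).const_mul (1 / 2)).mul (((hasDerivAt_id r).mul (h.sw.hr r t)).pow 2)).add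
      (((h.sρ.hr r t).rpow_const (Or.inl hp.ne')).const_mul (1 / (γ - 1)))).congr_deriv ?_
    simp

lemma WSol.AR (h : WSol μ β γ R T ρ w) {t : ℝ} (ht : t ∈ Ioo 0 T) : Af w R t = 0 := by
  have h1 : pt w R t = 0 := by
    have : HasDerivAt (fun τ => w R τ) 0 t := by
      refine (hasDerivAt_const t (0:ℝ)).congr_of_eventuallyEq ?_
      filter_upwards [Ioo_mem_nhds ht.1 ht.2] with τ hτ
      exact h.bc τ ⟨hτ.1.le, hτ.2.le⟩
    exact this.deriv
  rw [Af, h1, h.bc t ⟨ht.1.le, ht.2.le⟩]; simp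

lemma WSol.dPh (h : WSol μ β γ R T ρ w) {t : ℝ} (ht : t ∈ Ioo 0 T) :
    HasDerivAt (Ph μ β γ R ρ w) (-(∫ r in (0:ℝ)..R, ρ r t * (r * Af w r t) ^ 2 * r)
      + (-(∫ r in (0:ℝ)..R, ρ r t * (r * Af w r t) * (r * w r t) ^ 2) +
        (∫ r in (0:ℝ)..R, (1 / 2 * (2 * μ + ρ r t ^ β - β * ρ r t ^ β) * Df w r t ^ 3
          + (γ - 1) * (ρ r t ^ γ * Df w r t ^ 2) - Ff μ β γ ρ w r t * Df w r t ^ 2) * r))) t := by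
  have ht' : t ∈ Icc 0 T := ⟨ht.1.le, ht.2.le⟩
  have key := reynolds h.hR (T := T) (w := w)
    (g := fun r t => 1 / 2 * ((2 * μ + ρ r t ^ β) * Df w r t ^ 2) - ρ r t ^ γ * Df w r t)
    (gt := fun r t => 1 / 2 * (pt ρ r t * β * ρ r t ^ (β - 1) * Df w r t ^ 2
        + (2 * μ + ρ r t ^ β) * (2 * Df w r t * pt (Df w) r t))
      - (pt ρ r t * γ * ρ r t ^ (γ - 1) * Df w r t + ρ r t ^ γ * pt (Df w) r t))
    (gr := fun r t => 1 / 2 * (pr ρ r t * β * ρ r t ^ (β - 1) * Df w r t ^ 2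
        + (2 * μ + ρ r t ^ β) * (2 * Df w r t * pr (Df w) r t))
      - (pr ρ r t * γ * ρ r t ^ (γ - 1) * Df w r t + ρ r t ^ γ * pr (Df w) r t))
    h.sw h.bc ?_ ?_ ?_ ?_ ?_ ht
  · refine key.congr_deriv ?_
    have e1 : ∫ r in (0:ℝ)..R, ((1 / 2 * (pt ρ r t * β * ρ r t ^ (β - 1) * Df w r t ^ 2
            + (2 * μ + ρ r t ^ β) * (2 * Df w r t * pt (Df w) r t))
          - (pt ρ r t * γ * ρ r t ^ (γ - 1) * Df w r t + ρ r t ^ γ * pt (Df w) r t))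
        + r * w r t * (1 / 2 * (pr ρ r t * β * ρ r t ^ (β - 1) * Df w r t ^ 2
            + (2 * μ + ρ r t ^ β) * (2 * Df w r t * pr (Df w) r t))
          - (pr ρ r t * γ * ρ r t ^ (γ - 1) * Df w r t + ρ r t ^ γ * pr (Df w) r t))
        + (1 / 2 * ((2 * μ + ρ r t ^ β) * Df w r t ^ 2) - ρ r t ^ γ * Df w r t) * (2 * w r t + r * pr w r t)) * r
        = ∫ r in (0:ℝ)..R, (((1 / 2 * (2 * μ + ρ r t ^ β - β * ρ r t ^ β) * Df w r t ^ 3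
          + (γ - 1) * (ρ r t ^ γ * Df w r t ^ 2)) * r
          + Ff μ β γ ρ w r t * (2 * Af w r t + r * pr (Af w) r t) * r)
          - Ff μ β γ ρ w r t * ((w r t + r * pr w r t) ^ 2 + w r t ^ 2) * r) := by
      refine intervalIntegral.integral_congr fun r hr => ?_
      rw [uIcc_of_le h.hR.le] at hr
      have hp := h.pos r hr t ht'
      have ms := h.mass r hr t ht
      have ep : ∀ θ : ℝ, ρ r t ^ θ = ρ r t ^ (θ - 1) * ρ r t := by
        intro θ
        rw [← Real.rpow_add_one hp.ne']; congr 1; ring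
      have dd := Ddot h.sw r t
      have eβ := ep β
      have eγ := ep γ
      have eD : 2 * w r t + r * pr w r t = Df w r t := rfl
      have eF : Ff μ β γ ρ w r t = (2 * μ + ρ r t ^ β) * Df w r t - ρ r t ^ γ := rfl
      rw [eD, eF]
      generalize ρ r t ^ (β - 1) = x at *
      generalize ρ r t ^ (γ - 1) = y at *
      generalize ρ r t ^ β = X at *
      generalize ρ r t ^ γ = Y at *
      linear_combination ((1 / 2 * β * x * Df w r t ^ 2 - γ * y * Df w r t) * r) * ms
        + (((2 * μ + X) * Df w r t - Y) * r) * dd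
        + (1 / 2 * β * Df w r t ^ 3 * r) * eβ - (γ * Df w r t ^ 2 * r) * eγ
    have c1 := h.sρ.slr t
    have c2 := h.sw.slr t
    have c3 := h.sw.Af.slr t
    have c4 := h.sw.Df.slr t
    have c5 := h.cF t
    have c6 := h.sw.pr.slr t
    have c7 := h.sw.Af.pr.slr t
    have hcβ : Continuous fun r => ρ r t ^ β := c1.rpow_const (fun _ => Or.inr (by linarith [h.hβ]))
    have hcγ : Continuous fun r => ρ r t ^ γ := c1.rpow_const (fun _ => Or.inr (by linarith [h.hγ]))
    have e2 := ibp h.hR (fun r hr => h.mom r hr t ht) (by fun_prop) (fun r => h.sw.Af.hr r t) c7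
      (h.AR ht) c5 c3
    have e3 := ibp2 h.hR (fun r hr => h.mom r hr t ht) (by fun_prop) (fun r => h.sw.hr r t) c6
      (h.bc t ht') c5 c2
    have e4 : ∫ r in (0:ℝ)..R, (1 / 2 * (2 * μ + ρ r t ^ β - β * ρ r t ^ β) * Df w r t ^ 3
          + (γ - 1) * (ρ r t ^ γ * Df w r t ^ 2) - Ff μ β γ ρ w r t * Df w r t ^ 2) * r
        = (∫ r in (0:ℝ)..R, (1 / 2 * (2 * μ + ρ r t ^ β - β * ρ r t ^ β) * Df w r t ^ 3
          + (γ - 1) * (ρ r t ^ γ * Df w r t ^ 2)) * r)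
          - ∫ r in (0:ℝ)..R, Ff μ β γ ρ w r t * (2 * w r t + r * pr w r t) ^ 2 * r := by
      rw [← intervalIntegral.integral_sub]
      · refine intervalIntegral.integral_congr fun r _ => ?_
        simp only [Df]; ring
      · exact Continuous.intervalIntegrable (by fun_prop) _ _
      · exact Continuous.intervalIntegrable (by fun_prop) _ _
    have e5 : ∫ r in (0:ℝ)..R, ρ r t * (r * Af w r t) * (r * Af w r t) * r
        = ∫ r in (0:ℝ)..R, ρ r t * (r * Af w r t) ^ 2 * r :=
      intervalIntegral.integral_congr fun r _ => by ring
    rw [e1, intervalIntegral.integral_sub, intervalIntegral.integral_add, e3, e4, ← e5, e2]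
    · ring
    · exact Continuous.intervalIntegrable (by fun_prop) _ _
    · exact Continuous.intervalIntegrable (by fun_prop) _ _
    · exact Continuous.intervalIntegrable (by fun_prop) _ _
    · exact Continuous.intervalIntegrable (by fun_prop) _ _
  · exact (continuousOn_const.mul ((continuousOn_const.add (h.rp β)).mul ((h.sw.Df.co _).pow 2))).sub
      ((h.rp γ).mul (h.sw.Df.co _))
  · exact (continuousOn_const.mul (((((h.sρ.pt.co _).mul continuousOn_const).mul (h.rp _)).mul
        ((h.sw.Df.co _).pow 2)).add ((continuousOn_const.add (h.rp β)).mul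
        ((continuousOn_const.mul (h.sw.Df.co _)).mul (h.sw.Df.pt.co _))))).sub
      (((((h.sρ.pt.co _).mul continuousOn_const).mul (h.rp _)).mul (h.sw.Df.co _)).add
        ((h.rp γ).mul (h.sw.Df.pt.co _)))
  · exact (continuousOn_const.mul (((((h.sρ.pr.co _).mul continuousOn_const).mul (h.rp _)).mul
        ((h.sw.Df.co _).pow 2)).add ((continuousOn_const.add (h.rp β)).mul
        ((continuousOn_const.mul (h.sw.Df.co _)).mul (h.sw.Df.pr.co _))))).sub
      (((((h.sρ.pr.co _).mul continuousOn_const).mul (h.rp _)).mul (h.sw.Df.co _)).add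
        ((h.rp γ).mul (h.sw.Df.pr.co _)))
  · intro r hr t ht
    have hp := h.pos r hr t ⟨ht.1.le, ht.2.le⟩
    refine ((((((h.sρ.ht r t).rpow_const (Or.inl hp.ne')).const_add (2 * μ)).mul
      ((h.sw.Df.ht r t).pow 2)).const_mul (1 / 2)).sub
      (((h.sρ.ht r t).rpow_const (Or.inl hp.ne')).mul (h.sw.Df.ht r t))).congr_deriv ?_
    simp
  · intro r hr t ht
    have hp := h.pos r hr t ⟨ht.1.le, ht.2.le⟩
    refine ((((((h.sρ.hr r t).rpow_const (Or.inl hp.ne')).const_add (2 * μ)).mul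
      ((h.sw.Df.hr r t).pow 2)).const_mul (1 / 2)).sub
      (((h.sρ.hr r t).rpow_const (Or.inl hp.ne')).mul (h.sw.Df.hr r t))).congr_deriv ?_
    simp
end
end
end

section
open MeasureTheory Set Filter
open scoped Topology ContDiff
noncomputable section

section
variable {μ β γ R T : ℝ} {ρ w : ℝ → ℝ → ℝ}

lemma WSol.cβ (h : WSol μ β γ R T ρ w) (t : ℝ) : Continuous fun r => ρ r t ^ β :=
  (h.sρ.slr t).rpow_const (fun _ => Or.inr (by linarith [h.hβ]))

lemma WSol.cγ (h : WSol μ β γ R T ρ w) (t : ℝ) : Continuous fun r => ρ r t ^ γ :=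
  (h.sρ.slr t).rpow_const (fun _ => Or.inr (by linarith [h.hγ]))

lemma WSol.En_ge (h : WSol μ β γ R T ρ w) {t : ℝ} (ht : t ∈ Icc 0 T) :
    1 / 2 * (∫ r in (0:ℝ)..R, ρ r t * (r * w r t) ^ 2 * r)
      + 1 / (γ - 1) * (∫ r in (0:ℝ)..R, ρ r t ^ γ * r) = En γ R ρ w t
    ∧ 0 ≤ (∫ r in (0:ℝ)..R, ρ r t * (r * w r t) ^ 2 * r)
    ∧ 0 ≤ (∫ r in (0:ℝ)..R, ρ r t ^ γ * r) := by
  have c1 := h.sρ.slr t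
  have c2 := h.sw.slr t
  have c3 := h.cγ t
  refine ⟨?_, ?_, ?_⟩
  · rw [En, ← intervalIntegral.integral_const_mul, ← intervalIntegral.integral_const_mul,
      ← intervalIntegral.integral_add]
    · exact intervalIntegral.integral_congr fun r _ => by ring
    · exact Continuous.intervalIntegrable (by fun_prop) _ _
    · exact Continuous.intervalIntegrable (by fun_prop) _ _
  · refine intervalIntegral.integral_nonneg h.hR.le fun r hr => ?_
    have := h.pos r hr t ht
    have := hr.1
    positivity
  · refine intervalIntegral.integral_nonneg h.hR.le fun r hr => ?_
    have := h.pos r hr t ht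
    have := hr.1
    positivity

lemma WSol.Dis_nonneg (h : WSol μ β γ R T ρ w) {t : ℝ} (ht : t ∈ Icc 0 T) : 0 ≤ Dis μ β R ρ w t := by
  refine intervalIntegral.integral_nonneg h.hR.le fun r hr => ?_
  have := h.pos r hr t ht
  have := hr.1
  have := h.hμ
  positivity

lemma WSol.En_anti (h : WSol μ β γ R T ρ w) {t : ℝ} (ht : t ∈ Icc 0 T) :
    En γ R ρ w t ≤ En γ R ρ w 0 := by
  have : AntitoneOn (En γ R ρ w) (Icc 0 T) := by
    refine antitoneOn_of_deriv_nonpos (convex_Icc _ _) h.cEn ?_ ?_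
    · intro t ht
      rw [interior_Icc] at ht
      exact (h.dEn ht).differentiableAt.differentiableWithinAt
    · intro t ht
      rw [interior_Icc] at ht
      rw [(h.dEn ht).deriv]
      linarith [h.Dis_nonneg (t := t) ⟨ht.1.le, ht.2.le⟩]
  exact this ⟨le_rfl, h.hT.le⟩ ht ht.1

lemma WSol.Ph_eq (h : WSol μ β γ R T ρ w) (t : ℝ) : Ph μ β γ R ρ w t
    = 1 / 2 * Dis μ β R ρ w t - ∫ r in (0:ℝ)..R, ρ r t ^ γ * Df w r t * r := by
  have c1 := h.cβ t
  have c2 := h.cγ t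
  have c3 := h.sw.Df.slr t
  rw [Ph, Dis, ← intervalIntegral.integral_const_mul, ← intervalIntegral.integral_sub]
  · exact intervalIntegral.integral_congr fun r _ => by ring
  · exact Continuous.intervalIntegrable (by fun_prop) _ _
  · exact Continuous.intervalIntegrable (by fun_prop) _ _

lemma WSol.Y_low (h : WSol μ β γ R T ρ w) {M : ℝ} (hM : ∀ r ∈ Icc 0 R, ∀ t ∈ Icc 0 T, ρ r t ≤ M)
    {t : ℝ} (ht : t ∈ Icc 0 T) : Dis μ β R ρ w t / 4 + M ^ (2 * γ)
      ≤ Ph μ β γ R ρ w t + (R ^ 2 / (4 * μ) + 1) * M ^ (2 * γ) := by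
  rw [h.Ph_eq t]
  exact Y_lower h.hμ h.hβ h.hγ h.hR (h.sρ.slr t) (h.sw.Df.slr t) (fun r hr => h.pos r hr t ht)
    (fun r hr => hM r hr t ht) rfl rfl
end

lemma gron {μ β γ R α E : ℝ} (hμ : 0 < μ) (hβ : 1 < β) (hγ : 1 < γ) (hR : 0 < R)
    (hα0 : 0 < α) (hα1 : α < 1) (hE : 0 < E) :
    ∃ C > 0, ∀ (T : ℝ) (ρ w : ℝ → ℝ → ℝ) (M : ℝ), WSol μ β γ R T ρ w → 1 ≤ M →
      (∀ r ∈ Icc 0 R, ∀ t ∈ Icc 0 T, ρ r t ≤ M) → En γ R ρ w 0 ≤ E → ∀ t ∈ Icc 0 T,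
      Ph μ β γ R ρ w t + (R ^ 2 / (4 * μ) + 1) * M ^ (2 * γ)
        ≤ (Ph μ β γ R ρ w 0 + (R ^ 2 / (4 * μ) + 1) * M ^ (2 * γ)) * Real.exp (C * M ^ (1 + α * β)) := by
  have hγ1 : 0 < γ - 1 := by linarith
  obtain ⟨C, hC, key⟩ := static_main (E := (γ - 1) * E) hμ hβ hγ hR hα0 hα1 (by positivity)
  refine ⟨C * E, by positivity, ?_⟩
  intro T ρ w M h hM1 hM hE0 t ht
  have hM0 : 0 < M := by linarith
  set K := (R ^ 2 / (4 * μ) + 1) * M ^ (2 * γ) with hK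
  set c := C * M ^ (1 + α * β) with hc
  have hc0 : 0 ≤ c := by positivity
  set Z : ℝ → ℝ := fun t => (Ph μ β γ R ρ w t + K) * Real.exp (c * En γ R ρ w t) with hZ
  have hEn0 : ∀ t ∈ Icc 0 T, 0 ≤ En γ R ρ w t := by
    intro t ht
    obtain ⟨h1, h2, h3⟩ := h.En_ge ht
    rw [← h1]; positivity
  have hYn : ∀ t ∈ Icc 0 T, 0 ≤ Ph μ β γ R ρ w t + K := by
    intro t ht
    have h1 := h.Y_low hM ht
    have h2 := h.Dis_nonneg ht
    have h3 : 0 ≤ M ^ (2 * γ) := by positivity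
    linarith
  have hdZ : ∀ t ∈ Ioo 0 T, ∃ z ≤ 0, HasDerivAt Z z t := by
    intro t ht
    have ht' : t ∈ Icc 0 T := ⟨ht.1.le, ht.2.le⟩
    have h1 := ((h.dPh ht).add_const K).mul (((h.dEn ht).const_mul c).exp)
    refine ⟨_, ?_, h1⟩
    have hP : ∫ r in (0:ℝ)..R, ρ r t ^ γ * r ≤ (γ - 1) * E := by
      obtain ⟨h1, h2, h3⟩ := h.En_ge ht'
      have h4 := h.En_anti ht'
      have h5 : 1 / (γ - 1) * (∫ r in (0:ℝ)..R, ρ r t ^ γ * r) ≤ E := by linarith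
      rw [one_div, inv_mul_le_iff₀ hγ1] at h5
      exact h5
    have k := key M hM1 (fun r => ρ r t) (fun r => w r t) (fun r => pr w r t)
      (fun r => Ff μ β γ ρ w r t) (fun r => ρ r t * (r * Af w r t)) (fun r => Af w r t)
      (fun r => Df w r t) (Dis μ β R ρ w t) (Ph μ β γ R ρ w t + K) (h.sρ.slr t) (h.sw.slr t)
      (h.sw.pr.slr t) (h.sw.Af.slr t) (fun r => h.sw.hr r t) (h.bc t ht') (fun r => rfl)
      (fun r hr => h.pos r hr t ht') (fun r hr => hM r hr t ht') hP (fun r => rfl) (fun r => rfl)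
      (fun r hr => h.mom r hr t ht) rfl (by rw [h.Ph_eq t])
    rw [← hc] at k
    have hexp := Real.exp_pos (c * En γ R ρ w t)
    generalize Real.exp (c * En γ R ρ w t) = e at *
    generalize (-(∫ r in (0:ℝ)..R, ρ r t * (r * Af w r t) * (r * w r t) ^ 2) +
        (∫ r in (0:ℝ)..R, (1 / 2 * (2 * μ + ρ r t ^ β - β * ρ r t ^ β) * Df w r t ^ 3
          + (γ - 1) * (ρ r t ^ γ * Df w r t ^ 2) - Ff μ β γ ρ w r t * Df w r t ^ 2) * r)) = X at *
    generalize (∫ r in (0:ℝ)..R, ρ r t * (r * Af w r t) ^ 2 * r) = B at *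
    have h3 : (X - B - c * Dis μ β R ρ w t * (Ph μ β γ R ρ w t + K)) * e ≤ 0 :=
      mul_nonpos_of_nonpos_of_nonneg (by linarith) hexp.le
    linarith
  have hanti : AntitoneOn Z (Icc 0 T) := by
    refine antitoneOn_of_deriv_nonpos (convex_Icc _ _) ?_ ?_ ?_
    · exact (h.cPh.add continuousOn_const).mul (Real.continuous_exp.comp_continuousOn
        (continuousOn_const.mul h.cEn))
    · intro t ht
      rw [interior_Icc] at ht
      obtain ⟨z, hz, h1⟩ := hdZ t ht
      exact h1.differentiableAt.differentiableWithinAt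
    · intro t ht
      rw [interior_Icc] at ht
      obtain ⟨z, hz, h1⟩ := hdZ t ht
      rw [h1.deriv]; exact hz
  have h0 : (0:ℝ) ∈ Icc 0 T := ⟨le_rfl, h.hT.le⟩
  have hZZ := hanti h0 ht ht.1
  simp only [hZ] at hZZ
  have h1 : Ph μ β γ R ρ w t + K ≤ (Ph μ β γ R ρ w t + K) * Real.exp (c * En γ R ρ w t) :=
    le_mul_of_one_le_right (hYn t ht) (Real.one_le_exp (mul_nonneg hc0 (hEn0 t ht)))
  refine h1.trans (hZZ.trans ?_)
  refine mul_le_mul_of_nonneg_left (Real.exp_le_exp.2 ?_) (hYn 0 h0)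
  calc c * En γ R ρ w 0 ≤ c * E := by gcongr
    _ = _ := by rw [hc]; ring

end
end

section
open MeasureTheory Set Filter
open scoped Topology ContDiff
noncomputable section

lemma xi_split {μ β γ R T : ℝ} {ρ w : ℝ → ℝ → ℝ} (h : WSol μ β γ R T ρ w) {M E Y : ℝ} (hM1 : 1 ≤ M)
    (hM : ∀ r ∈ Icc 0 R, ∀ t ∈ Icc 0 T, ρ r t ≤ M) {t : ℝ} (ht : t ∈ Icc 0 T)
    (hEn : En γ R ρ w t ≤ E)
    (hY : Y = Ph μ β γ R ρ w t + (R ^ 2 / (4 * μ) + 1) * M ^ (2 * γ)) {r : ℝ} (hr : r ∈ Icc 0 R) :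
    |∫ s in R..r, ρ s t * (s * w s t)| ≤ M * R * √(2 / μ) + √(2 * E) * √(M * (Real.log Y / 2)) := by
  have hR := h.hR
  have hμ := h.hμ
  have hM0 : 0 < M := by linarith
  have c1 := h.sρ.slr t
  have c2 := h.sw.slr t
  have c3 := h.sw.pr.slr t
  have c4 := h.sw.Df.slr t
  have c5 := h.cβ t
  have hYl := h.Y_low hM ht
  rw [← hY] at hYl
  have hS0 := h.Dis_nonneg ht
  have hM2 : 1 ≤ M ^ (2 * γ) := Real.one_le_rpow hM1 (by linarith [h.hγ])
  have hY1 : 1 ≤ Y := by linarith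
  have hY0 : 0 < Y := by linarith
  obtain ⟨d, hd⟩ : ∃ d, d = ∫ s in (0:ℝ)..R, (2 * w s t + s * pr w s t) ^ 2 * s := ⟨_, rfl⟩
  have hdS : d * (2 * μ) ≤ Dis μ β R ρ w t := by
    rw [hd, Dis, ← intervalIntegral.integral_mul_const]
    refine intervalIntegral.integral_mono_on hR.le ?_ ?_ ?_
    · exact Continuous.intervalIntegrable (by fun_prop) _ _
    · exact Continuous.intervalIntegrable (by fun_prop) _ _
    · intro r hr
      have h1 : 0 < ρ r t ^ β := Real.rpow_pos_of_pos (h.pos r hr t ht) _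
      have h2 : 0 ≤ (2 * w r t + r * pr w r t) ^ 2 * r := mul_nonneg (sq_nonneg _) hr.1
      have h3 := mul_nonneg h1.le h2
      rw [Df]
      linarith
  have hdY : d ≤ 2 / μ * Y := by
    have : d * (2 * μ) ≤ (2 / μ * Y) * (2 * μ) := by
      have : 2 / μ * Y * (2 * μ) = 4 * Y := by field_simp; ring
      linarith
    exact le_of_mul_le_mul_right this (by positivity)
  have sd : √d ≤ √(2 / μ) * √Y := by
    rw [← Real.sqrt_mul (by positivity)]; exact Real.sqrt_le_sqrt hdY
  have sY : 1 ≤ √Y := Real.one_le_sqrt.2 hY1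
  obtain ⟨κ, hκ⟩ : ∃ κ, κ = R / √Y := ⟨_, rfl⟩
  have hκ0 : 0 < κ := by rw [hκ]; positivity
  have hκR : κ ≤ R := by rw [hκ]; exact div_le_self hR.le sY
  have hsup : ∀ s ∈ Icc 0 R, |s * w s t| ≤ √d := fun s hs => by
    rw [hd]
    exact Real.abs_le_sqrt (hardy_sup c2 c3 (fun r => h.sw.hr r t) (h.bc t ht) hs)
  have h1 : |∫ s in R..r, ρ s t * (s * w s t)| ≤ ∫ s in (0:ℝ)..R, |ρ s t * (s * w s t)| := by
    rw [intervalIntegral.integral_symm, abs_neg]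
    refine (intervalIntegral.abs_integral_le_integral_abs hr.2).trans ?_
    exact sub_int (Continuous.continuousOn (by fun_prop)) (fun s _ => abs_nonneg _) hr.1 hr.2 le_rfl
  have h2 : ∫ s in (0:ℝ)..R, |ρ s t * (s * w s t)| = (∫ s in (0:ℝ)..κ, |ρ s t * (s * w s t)|)
      + ∫ s in κ..R, |ρ s t * (s * w s t)| := by
    rw [intervalIntegral.integral_add_adjacent_intervals]
    · exact Continuous.intervalIntegrable (by fun_prop) _ _
    · exact Continuous.intervalIntegrable (by fun_prop) _ _
  have h3 : ∫ s in (0:ℝ)..κ, |ρ s t * (s * w s t)| ≤ M * R * √(2 / μ) := by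
    calc ∫ s in (0:ℝ)..κ, |ρ s t * (s * w s t)| ≤ ∫ _ in (0:ℝ)..κ, M * √d := by
          refine intervalIntegral.integral_mono_on hκ0.le ?_ ?_ ?_
          · exact Continuous.intervalIntegrable (by fun_prop) _ _
          · exact Continuous.intervalIntegrable (by fun_prop) _ _
          · intro s hs
            have hs' : s ∈ Icc 0 R := ⟨hs.1, hs.2.trans hκR⟩
            rw [abs_mul, abs_of_pos (h.pos s hs' t ht)]
            exact mul_le_mul (hM s hs' t ht) (hsup s hs') (abs_nonneg _) hM0.le
      _ = κ * (M * √d) := by simp; ring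
      _ ≤ κ * (M * (√(2 / μ) * √Y)) := by gcongr
      _ = _ := by rw [hκ]; field_simp
  have h4 : ∫ s in κ..R, |ρ s t * (s * w s t)| ≤ √(2 * E) * √(M * (Real.log Y / 2)) := by
    have hin : ∀ s ∈ Icc κ R, s ∈ Icc 0 R := fun s hs => ⟨hκ0.le.trans hs.1, hs.2⟩
    have cinv : ContinuousOn (fun s : ℝ => s⁻¹) (Icc κ R) :=
      continuousOn_id.inv₀ fun s hs => (hκ0.trans_le hs.1).ne'
    have a1 := cs_int' hκR (f := fun s => |s * w s t|) (g := fun s => s⁻¹) (k := fun s => ρ s t * s)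
      (Continuous.continuousOn (by fun_prop)) cinv (Continuous.continuousOn (by fun_prop))
      (fun s hs => mul_nonneg (h.pos s (hin s hs) t ht).le (hin s hs).1)
    have e1 : ∫ s in κ..R, |s * w s t| * s⁻¹ * (ρ s t * s) = ∫ s in κ..R, |ρ s t * (s * w s t)| := by
      refine intervalIntegral.integral_congr fun s hs => ?_
      rw [uIcc_of_le hκR] at hs
      have hs0 : s ≠ 0 := (hκ0.trans_le hs.1).ne'
      have hp := h.pos s (hin s hs) t ht
      rw [abs_mul (ρ s t), abs_of_pos hp]
      field_simp
    rw [e1] at a1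
    refine (le_abs_self _).trans (a1.trans ?_)
    have b1 : ∫ s in κ..R, |s * w s t| ^ 2 * (ρ s t * s) ≤ 2 * E := by
      obtain ⟨q1, q2, q3⟩ := h.En_ge ht
      have e2 : ∫ s in κ..R, |s * w s t| ^ 2 * (ρ s t * s) ≤ ∫ s in (0:ℝ)..R, |s * w s t| ^ 2 * (ρ s t * s) := by
        refine sub_int (Continuous.continuousOn (by fun_prop)) (fun s hs => ?_) hκ0.le hκR le_rfl
        have := h.pos s hs t ht
        have := hs.1
        positivity
      have e3 : ∫ s in (0:ℝ)..R, |s * w s t| ^ 2 * (ρ s t * s) = ∫ r in (0:ℝ)..R, ρ r t * (r * w r t) ^ 2 * r := by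
        refine intervalIntegral.integral_congr fun s hs => ?_
        simp only [sq_abs]; ring
      have hγ := h.hγ
      have : 0 ≤ 1 / (γ - 1) * (∫ r in (0:ℝ)..R, ρ r t ^ γ * r) :=
        mul_nonneg (one_div_nonneg.2 (by linarith)) q3
      linarith
    have b2 : ∫ s in κ..R, (s⁻¹) ^ 2 * (ρ s t * s) ≤ M * (Real.log Y / 2) := by
      have e2 : ∫ s in κ..R, (s⁻¹) ^ 2 * (ρ s t * s) ≤ ∫ s in κ..R, M * s⁻¹ := by
        refine intervalIntegral.integral_mono_on hκR ?_ ?_ ?_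
        · refine ContinuousOn.intervalIntegrable ?_
          rw [uIcc_of_le hκR]
          exact (cinv.pow 2).mul (Continuous.continuousOn (by fun_prop))
        · refine ContinuousOn.intervalIntegrable ?_
          rw [uIcc_of_le hκR]
          exact continuousOn_const.mul cinv
        · intro s hs
          have hs0 : 0 < s := hκ0.trans_le hs.1
          have hp := hM s (hin s hs) t ht
          calc _ = ρ s t * s⁻¹ := by field_simp
            _ ≤ _ := by gcongr
      rw [intervalIntegral.integral_const_mul, integral_inv_of_pos hκ0 hR] at e2
      have e3 : R / κ = √Y := by rw [hκ]; field_simp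
      rw [e3, Real.log_sqrt hY0.le] at e2
      exact e2
    gcongr
  linarith

/-- control of the initial quantities -/
lemma data0 {μ β γ R T M₁ M₂ M : ℝ} {ρ w u : ℝ → ℝ → ℝ} (h : WSol μ β γ R T ρ w)
    (hu : ∀ r, u r 0 = r * w r 0) (hM1 : 1 ≤ M)
    (hM : ∀ r ∈ Icc 0 R, ∀ t ∈ Icc 0 T, ρ r t ≤ M)
    (h1 : ∀ r ∈ Icc (0:ℝ) R, ρ r 0 ≤ M₁)
    (h2 : 2 * Real.pi * (∫ r in Ioo (0:ℝ) R, ((u r 0) ^ 2 + gradSq u r 0) * r) ≤ M₂) :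
    En γ R ρ w 0 ≤ 1 / 2 * |M₁| * |M₂| + 1 / (γ - 1) * (|M₁| ^ γ * (R ^ 2 / 2)) + 1 ∧
    Ph μ β γ R ρ w 0 + (R ^ 2 / (4 * μ) + 1) * M ^ (2 * γ)
      ≤ (3 / 4 * (2 * (2 * μ + 1) * |M₂|) + R ^ 2 / (4 * μ) + (R ^ 2 / (4 * μ) + 1)) * M ^ (β + 2 * γ) := by
  have hR := h.hR
  have hμ := h.hμ
  have hγ := h.hγ
  have hβ := h.hβ
  have hM0 : 0 < M := by linarith
  have ht : (0:ℝ) ∈ Icc 0 T := ⟨le_rfl, h.hT.le⟩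
  have c1 := h.sρ.slr 0
  have c2 := h.sw.slr 0
  have c3 := h.sw.pr.slr 0
  have c4 := h.sw.Df.slr 0
  have c5 := h.cβ 0
  have c6 := h.cγ 0
  obtain ⟨J, hJ⟩ : ∃ J, J = ∫ r in (0:ℝ)..R,
    ((r * w r 0) ^ 2 + ((w r 0 + r * pr w r 0) ^ 2 + w r 0 ^ 2)) * r := ⟨_, rfl⟩
  have hJ0 : 0 ≤ J := by
    rw [hJ]
    exact intervalIntegral.integral_nonneg hR.le fun r hr => mul_nonneg (by positivity) hr.1
  have hur : ∀ r, deriv (fun s => u s 0) r = w r 0 + r * pr w r 0 := by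
    intro r
    have e : (fun s => u s 0) = fun s => s * w s 0 := funext fun s => hu s
    rw [e]
    refine HasDerivAt.deriv (((hasDerivAt_id r).mul (h.sw.hr r 0)).congr_deriv ?_)
    simp
  have hJM : J ≤ |M₂| := by
    have e : ∫ r in Ioo (0:ℝ) R, ((u r 0) ^ 2 + gradSq u r 0) * r = J := by
      rw [hJ, intervalIntegral.integral_of_le hR.le, integral_Ioc_eq_integral_Ioo]
      refine setIntegral_congr_fun measurableSet_Ioo fun r hr => ?_
      have hr0 := hr.1.ne'
      simp only [gradSq, hur]
      rw [hu r, mul_div_cancel_left₀ _ hr0]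
    rw [e] at h2
    have := Real.pi_gt_three
    have h3 := le_abs_self M₂
    nlinarith
  have hM₁ : 0 < M₁ := (h.pos 0 ⟨le_rfl, hR.le⟩ 0 ht).trans_le (h1 0 ⟨le_rfl, hR.le⟩)
  constructor
  · obtain ⟨q1, q2, q3⟩ := h.En_ge ht
    rw [← q1]
    have k1 : (∫ r in (0:ℝ)..R, ρ r 0 * (r * w r 0) ^ 2 * r) ≤ |M₁| * |M₂| := by
      refine le_trans ?_ (mul_le_mul_of_nonneg_left hJM (abs_nonneg _))
      rw [hJ, ← intervalIntegral.integral_const_mul]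
      refine intervalIntegral.integral_mono_on hR.le ?_ ?_ ?_
      · exact Continuous.intervalIntegrable (by fun_prop) _ _
      · exact Continuous.intervalIntegrable (by fun_prop) _ _
      · intro r hr
        have hp := h.pos r hr 0 ht
        have hr0 := hr.1
        have h3 : ρ r 0 ≤ |M₁| := (h1 r hr).trans (le_abs_self _)
        rw [mul_assoc]
        gcongr
        have : 0 ≤ ((w r 0 + r * pr w r 0) ^ 2 + w r 0 ^ 2) := by positivity
        linarith
    have k2 : (∫ r in (0:ℝ)..R, ρ r 0 ^ γ * r) ≤ |M₁| ^ γ * (R ^ 2 / 2) := by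
      have : (∫ r in (0:ℝ)..R, ρ r 0 ^ γ * r) ≤ ∫ r in (0:ℝ)..R, |M₁| ^ γ * r := by
        refine intervalIntegral.integral_mono_on hR.le ?_ ?_ ?_
        · exact Continuous.intervalIntegrable (by fun_prop) _ _
        · exact Continuous.intervalIntegrable (by fun_prop) _ _
        · intro r hr
          have hp := h.pos r hr 0 ht
          have hr0 := hr.1
          have h3 : ρ r 0 ≤ |M₁| := (h1 r hr).trans (le_abs_self _)
          gcongr
      rw [intervalIntegral.integral_const_mul, integral_id] at this
      simpa using this
    have k3 : 1 / (γ - 1) * (∫ r in (0:ℝ)..R, ρ r 0 ^ γ * r) ≤ 1 / (γ - 1) * (|M₁| ^ γ * (R ^ 2 / 2)) :=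
      mul_le_mul_of_nonneg_left k2 (one_div_nonneg.2 (by linarith))
    linarith
  · rw [h.Ph_eq 0]
    have y1 := Y_bound (γ := γ) hμ hβ hγ hR c1 c4 (fun r hr => h.pos r hr 0 ht) (fun r hr => hM r hr 0 ht)
    have y2 := (neg_le_abs _).trans y1
    have eD : ∫ r in (0:ℝ)..R, (2 * μ + ρ r 0 ^ β) * Df w r 0 ^ 2 * r = Dis μ β R ρ w 0 := rfl
    rw [eD] at y2
    have hMβ : 1 ≤ M ^ β := Real.one_le_rpow hM1 (by linarith)
    have hMγ : 1 ≤ M ^ (2 * γ) := Real.one_le_rpow hM1 (by linarith)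
    have hS : Dis μ β R ρ w 0 ≤ 2 * (2 * μ + 1) * |M₂| * M ^ β := by
      have : Dis μ β R ρ w 0 ≤ ((2 * μ + 1) * M ^ β * 2) * J := by
        rw [Dis, hJ, ← intervalIntegral.integral_const_mul]
        refine intervalIntegral.integral_mono_on hR.le ?_ ?_ ?_
        · exact Continuous.intervalIntegrable (by fun_prop) _ _
        · exact Continuous.intervalIntegrable (by fun_prop) _ _
        · intro r hr
          have hp := h.pos r hr 0 ht
          have hr0 := hr.1
          have h3 : ρ r 0 ^ β ≤ M ^ β := Real.rpow_le_rpow hp.le (hM r hr 0 ht) (by linarith)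
          have h4 : 2 * μ + ρ r 0 ^ β ≤ (2 * μ + 1) * M ^ β := by
            have h5 := mul_le_mul_of_nonneg_left hMβ hμ.le
            linarith
          have h5 : Df w r 0 ^ 2 ≤ 2 * ((r * w r 0) ^ 2 + ((w r 0 + r * pr w r 0) ^ 2 + w r 0 ^ 2)) := by
            rw [Df]
            nlinarith [sq_nonneg (r * pr w r 0), sq_nonneg (r * w r 0)]
          calc _ ≤ (2 * μ + 1) * M ^ β * (2 * ((r * w r 0) ^ 2 + ((w r 0 + r * pr w r 0) ^ 2 + w r 0 ^ 2))) * r := by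
                gcongr
            _ = _ := by ring
      refine this.trans ?_
      calc _ ≤ ((2 * μ + 1) * M ^ β * 2) * |M₂| := by gcongr
        _ = _ := by ring
    rw [Real.rpow_add hM0]
    have z1 : M ^ β ≤ M ^ β * M ^ (2 * γ) := le_mul_of_one_le_right (by positivity) hMγ
    have z2 : M ^ (2 * γ) ≤ M ^ β * M ^ (2 * γ) := le_mul_of_one_le_left (by positivity) hMβ
    generalize M ^ β * M ^ (2 * γ) = W at *
    have w1 : Dis μ β R ρ w 0 ≤ 2 * (2 * μ + 1) * |M₂| * W := hS.trans (by gcongr)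
    have w2 : R ^ 2 / (4 * μ) * M ^ (2 * γ) ≤ R ^ 2 / (4 * μ) * W := by gcongr
    linarith

theorem xi_main
    (μ β γ R α M₁ M₂ : ℝ)
    (hμ : 0 < μ) (hβ : 1 < β) (hγ : 1 < γ) (hR : 0 < R) (hα : α ∈ Ioo (0:ℝ) 1) :
    ∃ C > 0, ∀ T > 0, ∀ (ρ u : ℝ → ℝ → ℝ) (RT : ℝ),
      RadialSolution μ β γ R T ρ u →
      (∀ r ∈ Icc (0:ℝ) R, ρ r 0 ≤ M₁) →
      (2 * Real.pi * (∫ r in Ioo (0:ℝ) R, ((u r 0) ^ 2 + gradSq u r 0) * r) ≤ M₂) →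
      RT = 1 + sSup (Set.image2 ρ (Icc 0 R) (Icc 0 T)) →
      ∀ r ∈ Icc (0:ℝ) R, ∀ t ∈ Icc (0:ℝ) T,
        |∫ s in R..r, ρ s t * u s t|
          ≤ C * (RT ^ (1 + α * β) + RT ^ (1 + γ / 2 - β)) := by
  have hγ1 : 0 < γ - 1 := by linarith
  obtain ⟨E, hE⟩ : ∃ E, E = 1 / 2 * |M₁| * |M₂| + 1 / (γ - 1) * (|M₁| ^ γ * (R ^ 2 / 2)) + 1 := ⟨_, rfl⟩
  have hE0 : 0 < E := by rw [hE]; positivity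
  obtain ⟨CY, hCY⟩ : ∃ CY, CY = 3 / 4 * (2 * (2 * μ + 1) * |M₂|) + R ^ 2 / (4 * μ) + (R ^ 2 / (4 * μ) + 1) :=
    ⟨_, rfl⟩
  have hCY0 : 0 < CY := by rw [hCY]; positivity
  obtain ⟨C, hC, key⟩ := gron hμ hβ hγ hR hα.1 hα.2 hE0
  have hα0 := hα.1
  obtain ⟨C2, hC2⟩ : ∃ C2, C2 = (CY + (β + 2 * γ) + C) / 2 := ⟨_, rfl⟩
  have hC20 : 0 < C2 := by rw [hC2]; positivity
  refine ⟨R * √(2 / μ) + √(2 * E) * √C2, by positivity, ?_⟩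
  intro T hT ρ u RT hsol h1 h2 hRT r hr t ht
  obtain ⟨h, hu⟩ := toW hsol
  have h0T : (0:ℝ) ∈ Icc 0 T := ⟨le_rfl, hT.le⟩
  have h0R : (0:ℝ) ∈ Icc 0 R := ⟨le_rfl, hR.le⟩
  have hbdd : BddAbove (Set.image2 ρ (Icc 0 R) (Icc 0 T)) := by
    have := ((isCompact_Icc (a := (0:ℝ)) (b := R)).prod (isCompact_Icc (a := (0:ℝ)) (b := T))).image h.sρ.cont
    rw [Set.image_uncurry_prod] at this
    exact this.bddAbove
  have hle : ∀ r ∈ Icc 0 R, ∀ t ∈ Icc 0 T, ρ r t ≤ sSup (Set.image2 ρ (Icc 0 R) (Icc 0 T)) :=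
    fun r hr t ht => le_csSup hbdd (Set.mem_image2_of_mem hr ht)
  have hM1 : 1 ≤ RT := by
    have a1 := hle 0 h0R 0 h0T
    have a2 := h.pos 0 h0R 0 h0T
    linarith
  have hM : ∀ r ∈ Icc 0 R, ∀ t ∈ Icc 0 T, ρ r t ≤ RT := fun r hr t ht => by
    have := hle r hr t ht
    linarith
  clear hRT
  have hM0 : 0 < RT := by linarith
  obtain ⟨d1, d2⟩ := data0 h (hu 0 h0T) hM1 hM h1 h2
  rw [← hE] at d1
  rw [← hCY] at d2
  have g := key T ρ (hq u) RT h hM1 hM d1 t ht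
  have hx := xi_split h hM1 hM ht ((h.En_anti ht).trans d1) rfl hr
  have hYl := h.Y_low hM ht
  have hS0 := h.Dis_nonneg ht
  have hM2 : 1 ≤ RT ^ (2 * γ) := Real.one_le_rpow hM1 (by linarith)
  generalize Ph μ β γ R ρ (hq u) t + (R ^ 2 / (4 * μ) + 1) * RT ^ (2 * γ) = Y at *
  have hY0 : 0 < Y := by linarith
  obtain ⟨m, hm⟩ : ∃ m, m = RT ^ (1 + α * β) := ⟨_, rfl⟩
  have hMm : RT ≤ m := by
    rw [hm]
    exact Real.self_le_rpow_of_one_le hM1 (by nlinarith)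
  have hm1 : 1 ≤ m := hM1.trans hMm
  have hlog : Real.log Y ≤ 2 * C2 * m := by
    have e1 : Y ≤ CY * RT ^ (β + 2 * γ) * Real.exp (C * m) := by
      rw [hm]
      exact g.trans (by gcongr)
    have e2 := Real.log_le_log hY0 e1
    rw [Real.log_mul (by positivity) (by positivity), Real.log_mul (by positivity) (by positivity),
      Real.log_exp, Real.log_rpow hM0] at e2
    have e3 : Real.log CY ≤ CY * m := by
      have := Real.log_le_self hCY0.le
      exact this.trans (le_mul_of_one_le_right hCY0.le hm1)
    have e4 : (β + 2 * γ) * Real.log RT ≤ (β + 2 * γ) * m := by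
      have := Real.log_le_self hM0.le
      gcongr
      linarith
    rw [hC2]
    linarith
  have hsq : √(RT * (Real.log Y / 2)) ≤ √C2 * m := by
    rw [Real.sqrt_le_iff]
    refine ⟨by positivity, ?_⟩
    rw [mul_pow, Real.sq_sqrt hC20.le]
    calc RT * (Real.log Y / 2) ≤ RT * (C2 * m) := by
          refine mul_le_mul_of_nonneg_left ?_ hM0.le
          linarith
      _ ≤ m * (C2 * m) := by gcongr
      _ = _ := by ring
  have eint : ∫ s in R..r, ρ s t * u s t = ∫ s in R..r, ρ s t * (s * hq u s t) :=
    intervalIntegral.integral_congr fun s _ => by rw [hu t ht s]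
  rw [eint, ← hm]
  refine hx.trans ?_
  have f1 : 0 ≤ RT ^ (1 + γ / 2 - β) := by positivity
  calc RT * R * √(2 / μ) + √(2 * E) * √(RT * (Real.log Y / 2))
      ≤ m * R * √(2 / μ) + √(2 * E) * (√C2 * m) := by gcongr
    _ = (R * √(2 / μ) + √(2 * E) * √C2) * (m + 0) := by ring
    _ ≤ _ := by gcongr

end
end

/-- **Time-uniform estimate of `ξ`.** With `R_T = 1 + sup_{[0,R]×[0,T]} ρ` and
`ξ(r,t) = ∫_R^r ρ u ds`, for any `α ∈ (0,1)` there is a constant `C(α)` depending only on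
`α, μ, β, γ, ‖ρ₀‖_{L^∞}, ‖u₀‖_{H¹}` (and `Ω`), independent of `T`, such that
`sup_{[0,R]×[0,T]} |ξ| ≤ C(α)(R_T^{1+αβ} + R_T^{1+γ/2−β})`. -/
theorem xi_uniform_estimate
    (μ β γ R α M₁ M₂ : ℝ)
    (hμ : 0 < μ) (hβ : 1 < β) (hγ : 1 < γ) (hR : 0 < R) (hα : α ∈ Ioo (0:ℝ) 1) :
    ∃ C > 0, ∀ T > 0, ∀ (ρ u : ℝ → ℝ → ℝ) (RT : ℝ),
      RadialSolution μ β γ R T ρ u →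
      (∀ r ∈ Icc (0:ℝ) R, ρ r 0 ≤ M₁) →
      (2 * Real.pi * (∫ r in Ioo (0:ℝ) R, ((u r 0) ^ 2 + gradSq u r 0) * r) ≤ M₂) →
      RT = 1 + sSup (Set.image2 ρ (Icc 0 R) (Icc 0 T)) →
      ∀ r ∈ Icc (0:ℝ) R, ∀ t ∈ Icc (0:ℝ) T,
        |∫ s in R..r, ρ s t * u s t|
          ≤ C * (RT ^ (1 + α * β) + RT ^ (1 + γ / 2 - β)) := by
  exact xi_main μ β γ R α M₁ M₂ hμ hβ hγ hR hα
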